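/- arXiv:2412.16912 — 7 statements merged into one kernel-verified Lean document; each statement's English description precedes it below -/
import Mathlib

section
/- There exist a constant C > 1 and an infinite set G of positive integers such that for every L ∈ G there is a rooted tree T on the square lattice ℤ² with L bonds whose number of growth sequences satisfies N(T) ≥ L!/C^L. -/
open SimpleGraph

/-- The edge set `S` forms a connected subgraph containing the root `r`:
every endpoint of an edge of `S` is reachable from `r` in the graph spanned by `S`. -/
def ConnFrom {V : Type} (r : V) (S : Set (Sym2 V)) : Prop :=
  ∀ e ∈ S, ∀ v ∈ e, (SimpleGraph.fromEdgeSet S).Reachable r v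

/-- Growth sequences of the edge set `T` (with `L` edges) from the root `r`:
bijective enumerations of the edges of `T` all of whose prefixes form a
connected subgraph containing `r`. -/
def growthSeqs {V : Type} (r : V) (T : Set (Sym2 V)) (L : ℕ) :
    Set (Fin L → Sym2 V) :=
  {f | Function.Injective f ∧ Set.range f = T ∧
    ∀ k : Fin L, ConnFrom r (f '' {i | i ≤ k})}

/-- `N(T)`: the number of growth sequences. -/
noncomputable def Ngrowth {V : Type} (r : V) (T : Set (Sym2 V)) (L : ℕ) : ℕ :=
  Nat.card (growthSeqs r T L)

/-- `e'` is strictly downstream of `e` in the rooted tree with edge set `T`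
and root `r`: `e' ≠ e` and every walk from an endpoint of `e'` to `r`
passes through `e`. -/
def Downstream {V : Type} (r : V) (T : Set (Sym2 V)) (e e' : Sym2 V) : Prop :=
  e' ∈ T ∧ e' ≠ e ∧
    ∀ v ∈ e', ∀ p : (SimpleGraph.fromEdgeSet T).Walk v r, e ∈ p.edges

/-- The weight `w(e)` of an edge: one plus the number of edges strictly
downstream of `e`. -/
noncomputable def wEdge {V : Type} (r : V) (T : Set (Sym2 V)) (e : Sym2 V) : ℕ :=
  1 + Nat.card {e' : Sym2 V | Downstream r T e e'}

/-- The weight `W(T)` of a rooted tree: the product of the edge weights. -/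
noncomputable def Wtree {V : Type} (r : V) (T : Finset (Sym2 V)) : ℕ :=
  ∏ e ∈ T, wEdge r (↑T) e

/-- An edge (bond) of the square lattice `ℤ²`: an unordered pair `{u, v}` of
points of `ℤ²` with `|u - v| = 1`. -/
def LatticeEdge (e : Sym2 (ℤ × ℤ)) : Prop :=
  ∃ u v : ℤ × ℤ, e = s(u, v) ∧ (u.1 - v.1) ^ 2 + (u.2 - v.2) ^ 2 = 1

open Finset in
/-- In a forest given by a parent map, every finite set of vertices has at least `n! / ∏ w`
parent-first orderings, provided `w v` bounds the number of descendants of `v`. -/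
theorem exists_parentFirst_orderings {V : Type} [DecidableEq V] (p : V → V) (rank : V → ℤ)
    (hrank : ∀ v, rank (p v) < rank v) (w : V → ℕ) (n : ℕ) (S : Finset V) (hS : #S = n)
    (hw : ∀ v ∈ S, Set.ncard {u | u ∈ S ∧ ∃ k, p^[k] u = v} ≤ w v) :
    ∃ A : Finset (List V),
      (∀ l ∈ A, l.Nodup ∧ (∀ v, v ∈ l ↔ v ∈ S) ∧ l.Pairwise fun a b => p a ≠ b) ∧
        n.factorial ≤ #A * ∏ v ∈ S, w v := by
  classical
  induction n generalizing S with
  | zero =>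
    obtain rfl := Finset.card_eq_zero.mp hS
    exact ⟨{[]}, by simp, by simp⟩
  | succ n ih =>
    have erase : ∀ v ∈ S, ∃ A : Finset (List V),
        (∀ l ∈ A, l.Nodup ∧ (∀ u, u ∈ l ↔ u ∈ S.erase v) ∧ l.Pairwise fun a b => p a ≠ b) ∧
          n.factorial ≤ #A * ∏ u ∈ S.erase v, w u := by
      intro v hv
      refine ih _ (by rw [Finset.card_erase_of_mem hv, hS]; rfl) fun u hu => ?_
      refine (Set.ncard_le_ncard ?_ ?_).trans (hw u (Finset.mem_of_mem_erase hu))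
      · exact fun a ha => ⟨Finset.mem_of_mem_erase ha.1, ha.2⟩
      · exact S.finite_toSet.subset fun a ha => ha.1
    choose! A hA hcard using erase
    set M := S.filter fun v => p v ∉ S
    have hMS : ∀ v ∈ M, v ∈ S := fun v hv => (Finset.mem_filter.mp hv).1
    have hsum : #S ≤ ∑ v ∈ M, w v := by
      have hcover : S ⊆ M.biUnion fun v => S.filter fun u => ∃ k, p^[k] u = v := by
        intro u hu
        obtain ⟨v, hv, hmin⟩ := Finset.exists_min_image
          (S.filter fun v => ∃ k, p^[k] u = v) rank ⟨u, by simpa [hu] using ⟨0, rfl⟩⟩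
        obtain ⟨hvS, k, hk⟩ := Finset.mem_filter.mp hv
        refine Finset.mem_biUnion.mpr ⟨v, Finset.mem_filter.mpr ⟨hvS, fun hp => ?_⟩,
          Finset.mem_filter.mpr ⟨hu, k, hk⟩⟩
        have := hmin (p v) (Finset.mem_filter.mpr
          ⟨hp, k + 1, by rw [Function.iterate_succ_apply', hk]⟩)
        exact absurd (hrank v) (not_lt.mpr this)
      refine (Finset.card_le_card hcover).trans (Finset.card_biUnion_le.trans ?_)
      refine Finset.sum_le_sum fun v hv => ?_
      have := hw v (hMS v hv)
      rwa [← Finset.coe_filter, Set.ncard_coe_finset] at this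
    refine ⟨M.biUnion fun v => (A v).image (List.cons v), ?_, ?_⟩
    · intro l hl
      obtain ⟨v, hv, hl⟩ := Finset.mem_biUnion.mp hl
      obtain ⟨t, ht, rfl⟩ := Finset.mem_image.mp hl
      obtain ⟨hvS, hpv⟩ := Finset.mem_filter.mp hv
      obtain ⟨hnd, hmem, hpw⟩ := hA v hvS t ht
      refine ⟨List.nodup_cons.mpr ⟨by simp [hmem], hnd⟩, fun u => ?_,
        List.pairwise_cons.mpr ⟨fun b hb h => ?_, hpw⟩⟩
      · by_cases huv : u = v <;> simp [hmem, huv, hvS]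
      · exact hpv (h ▸ Finset.mem_of_mem_erase ((hmem b).mp hb))
    · rw [Finset.card_biUnion]
      · rw [Finset.sum_mul, Nat.factorial_succ, ← hS]
        calc #S * n.factorial ≤ (∑ v ∈ M, w v) * n.factorial := Nat.mul_le_mul_right _ hsum
          _ = ∑ v ∈ M, w v * n.factorial := Finset.sum_mul ..
          _ ≤ _ := Finset.sum_le_sum fun v hv => by
            rw [Finset.card_image_of_injective _ List.cons_injective,
              ← Finset.mul_prod_erase S w (hMS v hv), mul_left_comm]
            exact Nat.mul_le_mul_left _ (hcard v (hMS v hv))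
      · intro u _ v _ huv
        refine Finset.disjoint_left.mpr fun l hu hv => huv ?_
        obtain ⟨s, _, rfl⟩ := Finset.mem_image.mp hu
        obtain ⟨t, _, h⟩ := Finset.mem_image.mp hv
        exact (List.cons.inj h).1.symm

section ParentForest

variable {V : Type} {p : V → V} {rank : V → ℤ}

theorem parentEdge_injective (hrank : ∀ v, rank (p v) < rank v) :
    Function.Injective fun v => s(v, p v) := by
  intro u v h
  rcases Sym2.eq_iff.mp h with h | ⟨h₁, h₂⟩
  · exact h.1
  · have hu := hrank u
    have hv := hrank v
    rw [h₂] at hu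
    rw [← h₁] at hv
    exact absurd hu (not_lt.mpr hv.le)

theorem iterate_parent_rank_le (hrank : ∀ v, rank (p v) < rank v) (k : ℕ) (v : V) :
    rank (p^[k] v) ≤ rank v := by
  induction k with
  | zero => exact le_rfl
  | succ k ih =>
    rw [Function.iterate_succ_apply']
    exact (hrank _).le.trans ih

theorem connFrom_parentEdges (hrank : ∀ v, rank (p v) < rank v) {r : V} {B : Set V}
    (hB : B.Finite) (hclosed : ∀ v ∈ B, p v = r ∨ p v ∈ B) :
    ConnFrom r ((fun v => s(v, p v)) '' B) := by
  set E := (fun v => s(v, p v)) '' B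
  have step : ∀ v ∈ B, (fromEdgeSet E).Adj (p v) v := fun v hv => by
    refine (fromEdgeSet_adj E).mpr ⟨⟨v, hv, Sym2.eq_swap⟩, fun h => ?_⟩
    exact absurd (hrank v) (by rw [h]; exact lt_irrefl _)
  have reach : ∀ v ∈ B, (fromEdgeSet E).Reachable r v := by
    by_contra! hcon
    obtain ⟨v, ⟨hv, hnot⟩, hmin⟩ := Set.exists_min_image
      {v | v ∈ B ∧ ¬ (fromEdgeSet E).Reachable r v} rank (hB.subset fun v hv => hv.1) hcon
    refine hnot (Reachable.trans ?_ (step v hv).reachable)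
    rcases hclosed v hv with h | h
    · rw [h]
    · by_contra hp
      exact absurd (hrank v) (not_lt.mpr (hmin _ ⟨h, hp⟩))
  rintro _ ⟨v, hv, rfl⟩ u hu
  rcases Sym2.mem_iff.mp hu with rfl | rfl
  · exact reach u hv
  · exact (reach v hv).trans (step v hv).symm.reachable

theorem isAcyclic_parentEdges (hrank : ∀ v, rank (p v) < rank v) (B : Set V) :
    (fromEdgeSet ((fun v => s(v, p v)) '' B)).IsAcyclic := by
  rw [isAcyclic_iff_forall_isBridge]
  intro e he
  rw [edgeSet_fromEdgeSet] at he
  obtain ⟨⟨v, hv, rfl⟩, -⟩ := he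
  rw [isBridge_iff]
  rintro ⟨walk⟩
  have invariant : ∀ {a b : V}, (fromEdgeSet ((fun v => s(v, p v)) '' B) \
      fromEdgeSet {s(v, p v)}).Walk a b → (∃ k, p^[k] a = v) → ∃ k, p^[k] b = v := by
    intro a b walk
    induction walk with
    | nil => exact id
    | @cons a b c hab _ ih =>
      rintro ⟨k, hk⟩
      refine ih ?_
      obtain ⟨hab, hne⟩ := (sdiff_adj ..).mp hab
      obtain ⟨⟨u, _, hu⟩, hab'⟩ := (fromEdgeSet_adj _).mp hab
      rcases Sym2.eq_iff.mp hu with ⟨rfl, rfl⟩ | ⟨rfl, rfl⟩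
      · cases k with
        | zero =>
          obtain rfl : u = v := hk
          exact absurd ((fromEdgeSet_adj _).mpr ⟨rfl, hab'⟩) hne
        | succ k => exact ⟨k, hk⟩
      · exact ⟨k + 1, hk⟩
  obtain ⟨k, hk⟩ := invariant walk ⟨0, rfl⟩
  have := iterate_parent_rank_le hrank k (p v)
  rw [hk] at this
  exact absurd (hrank v) (not_lt.mpr this)

theorem growthSeqs_finite (r : V) {T : Set (Sym2 V)} (hT : T.Finite) (L : ℕ) :
    (growthSeqs r T L).Finite :=
  (Set.Finite.pi' fun _ : Fin L => hT).subset fun _ hf i => hf.2.1 ▸ Set.mem_range_self i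

theorem parentFirst_mem_growthSeqs (hrank : ∀ v, rank (p v) < rank v) {r : V} {S : Finset V}
    (hclosed : ∀ v ∈ S, p v = r ∨ p v ∈ S) {L : ℕ} {g : Fin L → V}
    (hinj : Function.Injective g) (hrange : ∀ v, v ∈ Set.range g ↔ v ∈ S)
    (hfirst : ∀ i j, i < j → p (g i) ≠ g j) :
    (fun i => s(g i, p (g i))) ∈ growthSeqs r ((fun v => s(v, p v)) '' (S : Set V)) L := by
  refine ⟨(parentEdge_injective hrank).comp hinj, ?_, fun k => ?_⟩
  · have : Set.range g = (S : Set V) := Set.ext hrange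
    rw [← this, ← Set.range_comp]
    rfl
  · have := connFrom_parentEdges hrank (r := r) (B := g '' {i | i ≤ k}) (Set.toFinite _) ?_
    · rwa [← Set.image_comp] at this
    rintro _ ⟨i, hi, rfl⟩
    refine (hclosed _ ((hrange _).mp ⟨i, rfl⟩)).imp_right fun h => ?_
    obtain ⟨j, hj⟩ := (hrange _).mpr h
    have hji : j ≤ i := not_lt.mp fun hij => hfirst i j hij hj.symm
    exact ⟨j, hji.trans hi, hj⟩

/-- Hook-type lower bound for the number of growth sequences of a tree given by a parent map. -/
theorem factorial_le_Ngrowth_mul_prod (hrank : ∀ v, rank (p v) < rank v) {r : V} {S : Finset V}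
    (hclosed : ∀ v ∈ S, p v = r ∨ p v ∈ S) (w : V → ℕ)
    (hw : ∀ v ∈ S, Set.ncard {u | u ∈ S ∧ ∃ k, p^[k] u = v} ≤ w v) :
    S.card.factorial ≤
      Ngrowth r ((fun v => s(v, p v)) '' (S : Set V)) S.card * ∏ v ∈ S, w v := by
  classical
  obtain ⟨A, hA, hcard⟩ := exists_parentFirst_orderings p rank hrank w S.card S rfl hw
  refine hcard.trans (Nat.mul_le_mul_right _ ?_)
  have hlen : ∀ l ∈ A, l.length = S.card := fun l hl => by
    rw [← List.toFinset_card_of_nodup (hA l hl).1]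
    congr 1
    ext v
    simpa using (hA l hl).2.1 v
  let Φ : A → growthSeqs r ((fun v => s(v, p v)) '' (S : Set V)) S.card := fun l =>
    ⟨fun i => s(l.1.get (i.cast (hlen _ l.2).symm), p (l.1.get (i.cast (hlen _ l.2).symm))), by
      obtain ⟨hnd, hmem, hpw⟩ := hA _ l.2
      refine parentFirst_mem_growthSeqs hrank hclosed
        (g := fun i => l.1.get (i.cast (hlen _ l.2).symm)) ?_ (fun v => ?_) ?_
      · exact (List.nodup_iff_injective_get.mp hnd).comp (Fin.cast_injective _)
      · rw [← hmem, List.mem_iff_get]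
        exact ⟨fun ⟨i, hi⟩ => ⟨_, hi⟩, fun ⟨i, hi⟩ => ⟨i.cast (hlen _ l.2), hi⟩⟩
      · exact fun i j hij => List.pairwise_iff_get.mp hpw _ _ hij⟩
  have : Finite (growthSeqs r ((fun v => s(v, p v)) '' (S : Set V)) S.card) :=
    growthSeqs_finite r (S.finite_toSet.image _) _
  have hinj : Function.Injective Φ := by
    intro l l' h
    refine Subtype.ext (List.ext_get ((hlen _ l.2).trans (hlen _ l'.2).symm) fun i hi hi' => ?_)
    exact parentEdge_injective hrank
      (congrFun (congrArg Subtype.val h) ⟨i, (hlen _ l.2) ▸ hi⟩)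
  simpa [Ngrowth] using Nat.card_le_card_of_injective Φ hinj

end ParentForest

/-- The parent of a lattice point in the dyadic tree: move left if every power of two dividing
the first coordinate divides the second one, and down otherwise. -/
noncomputable def dyadicParent (v : ℤ × ℤ) : ℤ × ℤ :=
  open Classical in
  if ∀ k : ℕ, (2 : ℤ) ^ k ∣ v.1 → (2 : ℤ) ^ k ∣ v.2 then (v.1 - 1, v.2) else (v.1, v.2 - 1)

/-- The point `v` lies on a grid line of mesh `2 ^ m`. -/
def OnDyadicGrid (m : ℕ) (v : ℤ × ℤ) : Prop :=
  (2 : ℤ) ^ m ∣ v.1 ∨ (2 : ℤ) ^ m ∣ v.2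

theorem dyadicParent_rank (v : ℤ × ℤ) :
    (dyadicParent v).1 + (dyadicParent v).2 < v.1 + v.2 := by
  unfold dyadicParent
  split_ifs <;> dsimp only <;> omega

theorem latticeEdge_dyadicParent (v : ℤ × ℤ) : LatticeEdge s(v, dyadicParent v) := by
  refine ⟨v, dyadicParent v, rfl, ?_⟩
  unfold dyadicParent
  split_ifs <;> simp

theorem OnDyadicGrid.dyadicParent {m : ℕ} {v : ℤ × ℤ} (h : OnDyadicGrid m v) :
    OnDyadicGrid m (dyadicParent v) := by
  unfold _root_.dyadicParent
  split_ifs with hv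
  · exact Or.inr (h.elim (hv m) id)
  · push Not at hv
    obtain ⟨k, hk₁, hk₂⟩ := hv
    refine Or.inl (h.elim id fun h₂ => ?_)
    have hmk : m ≤ k := by
      by_contra! hkm
      exact hk₂ ((pow_dvd_pow 2 hkm.le).trans h₂)
    exact (pow_dvd_pow 2 hmk).trans hk₁

theorem OnDyadicGrid.of_le {m n : ℕ} (hmn : m ≤ n) {v : ℤ × ℤ} (h : OnDyadicGrid n v) :
    OnDyadicGrid m v :=
  h.imp (pow_dvd_pow 2 hmn).trans (pow_dvd_pow 2 hmn).trans

theorem Int.sub_one_ediv_of_not_dvd {a d : ℤ} (hd : 0 < d) (h : ¬ d ∣ a) :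
    (a - 1) / d = a / d := by
  have hpos : 0 < a % d :=
    lt_of_le_of_ne (Int.emod_nonneg a hd.ne') fun h0 => h (Int.dvd_of_emod_eq_zero h0.symm)
  have hlt := Int.emod_lt_of_pos a hd
  have hdiv := Int.emod_add_mul_ediv a d
  rw [Int.ediv_eq_iff_of_pos hd]
  constructor <;> nlinarith

theorem dyadicParent_cell {m : ℕ} {v : ℤ × ℤ} (h : ¬ OnDyadicGrid m v) :
    (dyadicParent v).1 / 2 ^ m = v.1 / 2 ^ m ∧ (dyadicParent v).2 / 2 ^ m = v.2 / 2 ^ m := by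
  obtain ⟨h₁, h₂⟩ := not_or.mp h
  have hd : (0 : ℤ) < 2 ^ m := by positivity
  unfold dyadicParent
  split_ifs
  · exact ⟨Int.sub_one_ediv_of_not_dvd hd h₁, rfl⟩
  · exact ⟨rfl, Int.sub_one_ediv_of_not_dvd hd h₂⟩

theorem dyadicParent_iterate_cell {m : ℕ} (k : ℕ) {u : ℤ × ℤ}
    (h : ¬ OnDyadicGrid m (dyadicParent^[k] u)) :
    u.1 / 2 ^ m = (dyadicParent^[k] u).1 / 2 ^ m ∧
      u.2 / 2 ^ m = (dyadicParent^[k] u).2 / 2 ^ m := by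
  induction k with
  | zero => exact ⟨rfl, rfl⟩
  | succ k ih =>
    rw [Function.iterate_succ_apply'] at h ⊢
    have h' : ¬ OnDyadicGrid m (dyadicParent^[k] u) := fun hu => h hu.dyadicParent
    obtain ⟨h₁, h₂⟩ := ih h'
    obtain ⟨h₃, h₄⟩ := dyadicParent_cell h'
    exact ⟨h₁.trans h₃.symm, h₂.trans h₄.symm⟩

theorem ncard_descendants_le {m : ℕ} {v : ℤ × ℤ} (h : ¬ OnDyadicGrid m v) (S : Finset (ℤ × ℤ)) :
    Set.ncard {u | u ∈ S ∧ ∃ k, dyadicParent^[k] u = v} ≤ 4 ^ m := by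
  have hd : (0 : ℤ) < 2 ^ m := by positivity
  have hsub : {u | u ∈ S ∧ ∃ k, dyadicParent^[k] u = v} ⊆
      ((Finset.Ico (v.1 / 2 ^ m * 2 ^ m) (v.1 / 2 ^ m * 2 ^ m + 2 ^ m) ×ˢ
        Finset.Ico (v.2 / 2 ^ m * 2 ^ m) (v.2 / 2 ^ m * 2 ^ m + 2 ^ m) : Finset (ℤ × ℤ)) :
          Set (ℤ × ℤ)) := by
    rintro u ⟨-, k, rfl⟩
    obtain ⟨h₁, h₂⟩ := dyadicParent_iterate_cell k h
    rw [Finset.mem_coe, Finset.mem_product, Finset.mem_Ico, Finset.mem_Ico, ← h₁, ← h₂]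
    exact ⟨⟨Int.ediv_mul_le _ hd.ne', Int.lt_ediv_add_one_mul_self _ hd |>.trans_eq (by ring)⟩,
      ⟨Int.ediv_mul_le _ hd.ne', Int.lt_ediv_add_one_mul_self _ hd |>.trans_eq (by ring)⟩⟩
  refine (Set.ncard_le_ncard hsub (Finset.finite_toSet _)).trans ?_
  rw [Set.ncard_coe_finset, Finset.card_product, Int.card_Ico, Int.card_Ico,
    add_sub_cancel_left, add_sub_cancel_left]
  have : ((2 : ℤ) ^ m).toNat = 2 ^ m := by
    rw [← Int.toNat_natCast (2 ^ m)]
    norm_num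
  rw [this, ← mul_pow]
  norm_num

/-- The square `[0, 2 ^ n)²` of lattice points. -/
noncomputable def dyadicBox (n : ℕ) : Finset (ℤ × ℤ) :=
  Finset.Ico 0 (2 ^ n) ×ˢ Finset.Ico 0 (2 ^ n)

theorem Int.card_Ico_zero_two_pow (n : ℕ) : (Finset.Ico (0 : ℤ) (2 ^ n)).card = 2 ^ n := by
  rw [Int.card_Ico, sub_zero, ← Int.toNat_natCast (2 ^ n)]
  norm_num

theorem card_dyadicBox (n : ℕ) : (dyadicBox n).card = 4 ^ n := by
  rw [dyadicBox, Finset.card_product, Int.card_Ico_zero_two_pow, ← mul_pow]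
  norm_num

theorem dyadicParent_mem_box {n : ℕ} {v : ℤ × ℤ} (hv : v ∈ (dyadicBox n).erase 0) :
    dyadicParent v = 0 ∨ dyadicParent v ∈ (dyadicBox n).erase 0 := by
  rw [or_iff_not_imp_left]
  intro hne
  refine Finset.mem_erase.mpr ⟨hne, ?_⟩
  obtain ⟨hv0, hbox⟩ := Finset.mem_erase.mp hv
  obtain ⟨x, y⟩ := v
  simp only [dyadicBox, Finset.mem_product, Finset.mem_Ico] at hbox ⊢
  unfold dyadicParent
  split_ifs with h
  · have hx : x ≠ 0 := by
      rintro rfl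
      refine hv0 (Prod.ext rfl (Int.eq_zero_of_abs_lt_dvd (h n (dvd_zero _)) ?_))
      rw [abs_of_nonneg hbox.2.1]
      exact hbox.2.2
    dsimp only
    omega
  · have hy : y ≠ 0 := by
      rintro rfl
      exact h fun k _ => dvd_zero _
    dsimp only
    omega

open Classical in
/-- The logarithm in base four of a bound for the number of descendants of `v` in the box. -/
noncomputable def dyadicLevel (n : ℕ) (v : ℤ × ℤ) : ℕ :=
  ((Finset.range n).filter fun k => OnDyadicGrid k v).card

theorem dyadicLevel_spec (n : ℕ) (v : ℤ × ℤ) :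
    dyadicLevel n v = n ∨ ¬ OnDyadicGrid (dyadicLevel n v) v := by
  classical
  by_contra! hcon
  obtain ⟨hne, hon⟩ := hcon
  have hlt : dyadicLevel n v < n :=
    lt_of_le_of_ne ((Finset.card_filter_le _ _).trans_eq (Finset.card_range n)) hne
  have hsub : Finset.range (dyadicLevel n v + 1) ⊆
      (Finset.range n).filter fun k => OnDyadicGrid k v := fun k hk => by
    have hk' := Finset.mem_range.mp hk
    exact Finset.mem_filter.mpr ⟨Finset.mem_range.mpr (by omega), hon.of_le (by omega)⟩
  have := Finset.card_le_card hsub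
  rw [Finset.card_range] at this
  exact absurd this (by simp [dyadicLevel])

theorem ncard_box_descendants_le (n : ℕ) (v : ℤ × ℤ) :
    Set.ncard {u | u ∈ (dyadicBox n).erase 0 ∧ ∃ k, dyadicParent^[k] u = v} ≤
      4 ^ dyadicLevel n v := by
  rcases dyadicLevel_spec n v with h | h
  · rw [h, ← card_dyadicBox, ← Set.ncard_coe_finset]
    exact Set.ncard_le_ncard (fun u hu => Finset.mem_of_mem_erase hu.1) (Finset.finite_toSet _)
  · exact ncard_descendants_le h _

theorem card_multiples_le {k n : ℕ} (hkn : k ≤ n) :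
    ((Finset.Ico (0 : ℤ) (2 ^ n)).filter fun x => (2 : ℤ) ^ k ∣ x).card ≤ 2 ^ (n - k) := by
  have hd : (0 : ℤ) < 2 ^ k := by positivity
  have hsub : ((Finset.Ico (0 : ℤ) (2 ^ n)).filter fun x => (2 : ℤ) ^ k ∣ x) ⊆
      (Finset.Ico (0 : ℤ) (2 ^ (n - k))).image fun y => 2 ^ k * y := by
    intro x hx
    obtain ⟨hx, y, rfl⟩ := Finset.mem_filter.mp hx
    obtain ⟨h₁, h₂⟩ := Finset.mem_Ico.mp hx
    refine Finset.mem_image.mpr ⟨y, Finset.mem_Ico.mpr ⟨?_, ?_⟩, rfl⟩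
    · exact nonneg_of_mul_nonneg_right h₁ hd
    · rw [← Nat.add_sub_cancel' hkn, pow_add] at h₂
      exact lt_of_mul_lt_mul_left h₂ hd.le
  exact (Finset.card_le_card hsub).trans
    (Finset.card_image_le.trans_eq (Int.card_Ico_zero_two_pow _))

open Classical in
theorem card_box_onDyadicGrid_le {k n : ℕ} (hkn : k ≤ n) :
    ((dyadicBox n).filter fun v => OnDyadicGrid k v).card ≤ 2 * (2 ^ (n - k) * 2 ^ n) := by
  set I := Finset.Ico (0 : ℤ) (2 ^ n)
  set J := I.filter fun x => (2 : ℤ) ^ k ∣ x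
  have hsub : ((dyadicBox n).filter fun v => OnDyadicGrid k v) ⊆ J ×ˢ I ∪ I ×ˢ J := by
    intro v hv
    obtain ⟨hbox, hgrid⟩ := Finset.mem_filter.mp hv
    obtain ⟨h₁, h₂⟩ := Finset.mem_product.mp hbox
    rw [Finset.mem_union, Finset.mem_product, Finset.mem_product]
    exact hgrid.imp (fun h => ⟨Finset.mem_filter.mpr ⟨h₁, h⟩, h₂⟩)
      fun h => ⟨h₁, Finset.mem_filter.mpr ⟨h₂, h⟩⟩
  refine (Finset.card_le_card hsub).trans ((Finset.card_union_le _ _).trans ?_)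
  rw [Finset.card_product, Finset.card_product, Int.card_Ico_zero_two_pow]
  have : J.card * 2 ^ n ≤ 2 ^ (n - k) * 2 ^ n := Nat.mul_le_mul_right _ <| by
    convert card_multiples_le hkn
  rw [mul_comm (2 ^ n) J.card]
  omega

theorem sum_dyadicLevel_le (n : ℕ) : ∑ v ∈ dyadicBox n, dyadicLevel n v ≤ 4 * 4 ^ n := by
  classical
  have hgeom : ∀ m ≤ n, ∑ k ∈ Finset.range m, 2 ^ (n - k) + 2 * 2 ^ (n - m) = 2 * 2 ^ n := by
    intro m hm
    induction m with
    | zero => simp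
    | succ m ih =>
      rw [Finset.sum_range_succ, ← ih (by omega), show n - m = n - (m + 1) + 1 by omega, pow_succ]
      ring
  have hgeom' : ∑ k ∈ Finset.range n, 2 ^ (n - k) ≤ 2 * 2 ^ n :=
    (Nat.le_add_right _ _).trans (hgeom n le_rfl).le
  calc ∑ v ∈ dyadicBox n, dyadicLevel n v
      = ∑ k ∈ Finset.range n, ((dyadicBox n).filter fun v => OnDyadicGrid k v).card :=
        Finset.sum_card_bipartiteAbove_eq_sum_card_bipartiteBelow fun v k => OnDyadicGrid k v
    _ ≤ ∑ k ∈ Finset.range n, 2 * (2 ^ (n - k) * 2 ^ n) :=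
        Finset.sum_le_sum fun k hk => card_box_onDyadicGrid_le (Finset.mem_range.mp hk).le
    _ = 2 * ((∑ k ∈ Finset.range n, 2 ^ (n - k)) * 2 ^ n) := by
        rw [← Finset.mul_sum, Finset.sum_mul]
    _ ≤ 2 * (2 * 2 ^ n * 2 ^ n) := by gcongr
    _ = 4 * 4 ^ n := by
        rw [show 4 ^ n = 2 ^ n * 2 ^ n by rw [← mul_pow]; norm_num]
        ring

theorem prod_dyadicWeight_le {n : ℕ} (hn : 1 ≤ n) :
    ∏ v ∈ (dyadicBox n).erase 0, 4 ^ dyadicLevel n v ≤ (4 ^ 8) ^ (4 ^ n - 1) := by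
  rw [Finset.prod_pow_eq_pow_sum, ← pow_mul]
  refine Nat.pow_le_pow_right (by norm_num) ?_
  have h₁ : ∑ v ∈ (dyadicBox n).erase 0, dyadicLevel n v ≤ ∑ v ∈ dyadicBox n, dyadicLevel n v :=
    Finset.sum_le_sum_of_subset (Finset.erase_subset _ _)
  have h₂ := sum_dyadicLevel_le n
  have h₃ : 4 ^ 1 ≤ 4 ^ n := Nat.pow_le_pow_right (by norm_num) hn
  omega

/-- **Bouch's theorem.** There exist a constant `C > 1` and an
infinite set `G` of positive integers such that for every `L ∈ G` there is a
rooted tree `T` on the square lattice `ℤ²` with `L` bonds whose number of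
growth sequences satisfies `N(T) ≥ L!/C^L`. -/
theorem bouch_theorem :
    ∃ C : ℝ, 1 < C ∧ ∃ G : Set ℕ, G.Infinite ∧
      ∀ L ∈ G, 0 < L ∧
        ∃ (T : Finset (Sym2 (ℤ × ℤ))) (r : ℤ × ℤ),
          T.card = L ∧
          (∀ e ∈ T, LatticeEdge e) ∧
          ConnFrom r (↑T : Set (Sym2 (ℤ × ℤ))) ∧
          (SimpleGraph.fromEdgeSet (↑T : Set (Sym2 (ℤ × ℤ)))).IsAcyclic ∧
          (∃ e ∈ T, r ∈ e) ∧
          (L.factorial : ℝ) / C ^ L ≤ Ngrowth r (↑T) L := by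
  classical
  refine ⟨4 ^ 8, by norm_num, Set.range fun n : ℕ => 4 ^ (n + 1) - 1, ?_, ?_⟩
  · refine Set.infinite_range_of_injective fun m n h => ?_
    have hm : 0 < 4 ^ (m + 1) := by positivity
    have hn : 0 < 4 ^ (n + 1) := by positivity
    have : 4 ^ (m + 1) = 4 ^ (n + 1) := by omega
    exact Nat.succ_injective (Nat.pow_right_injective (show 2 ≤ 4 by norm_num) this)
  rintro _ ⟨m, rfl⟩
  have hn : 1 ≤ m + 1 := by omega
  dsimp only
  generalize m + 1 = n at hn
  have hfour : 4 ^ 1 ≤ 4 ^ n := Nat.pow_le_pow_right (by norm_num) hn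
  have hpos : (1 : ℤ) < 2 ^ n := one_lt_pow₀ (by norm_num) (by omega)
  set S := (dyadicBox n).erase 0 with hS
  have hcard : S.card = 4 ^ n - 1 := by
    rw [hS, Finset.card_erase_of_mem, card_dyadicBox]
    simp [dyadicBox]
  have hcoe : ((S.image fun v => s(v, dyadicParent v) : Finset (Sym2 (ℤ × ℤ))) :
      Set (Sym2 (ℤ × ℤ))) = (fun v => s(v, dyadicParent v)) '' (S : Set (ℤ × ℤ)) :=
    Finset.coe_image
  refine ⟨by omega, S.image fun v => s(v, dyadicParent v), 0, ?_, ?_, ?_, ?_, ?_, ?_⟩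
  · rw [Finset.card_image_of_injective _ (parentEdge_injective dyadicParent_rank), hcard]
  · intro e he
    obtain ⟨v, _, rfl⟩ := Finset.mem_image.mp he
    exact latticeEdge_dyadicParent v
  · rw [hcoe]
    exact connFrom_parentEdges dyadicParent_rank S.finite_toSet fun v hv => dyadicParent_mem_box hv
  · rw [hcoe]
    exact isAcyclic_parentEdges dyadicParent_rank _
  · refine ⟨s((1, 0), dyadicParent (1, 0)), Finset.mem_image_of_mem _ ?_, ?_⟩
    · simp [hS, dyadicBox, hpos]
    · simp [dyadicParent, Prod.zero_eq_mk]
  · have hhook := factorial_le_Ngrowth_mul_prod dyadicParent_rank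
      (fun v hv => dyadicParent_mem_box hv) (fun v => 4 ^ dyadicLevel n v)
      fun v (_ : v ∈ S) => ncard_box_descendants_le n v
    have hbound := hhook.trans (Nat.mul_le_mul_left _ (prod_dyadicWeight_le hn))
    rw [hcoe, div_le_iff₀ (by positivity)]
    rw [hcard] at hbound
    exact_mod_cast hbound
end

section
/- For every finite rooted tree T with L edges, the number of growth sequences is N(T) = L! / W(T); equivalently, N(T) · W(T) = L!. -/
open SimpleGraph

section LinearExtensions

variable {α : Type*}

/-- Enumerations of `S` by `Fin n` in which `D a b` forces `a` to come before `b`. -/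
def linExts (D : α → α → Prop) (S : Finset α) (n : ℕ) : Set (Fin n → α) :=
  {f | Function.Injective f ∧ Set.range f = ↑S ∧ ∀ i j, D (f i) (f j) → i < j}

open scoped Classical in
/-- The `D`-minimal elements of `S`. -/
noncomputable def minElts (D : α → α → Prop) (S : Finset α) : Finset α :=
  {a ∈ S | ∀ b ∈ S, ¬ D b a}

open scoped Classical in
/-- The elements of `S` that are equal to or `D`-above `a`. -/
noncomputable def upSet (D : α → α → Prop) (S : Finset α) (a : α) : Finset α :=
  {b ∈ S | b = a ∨ D a b}

lemma mem_minElts {D : α → α → Prop} {S : Finset α} {a : α} :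
    a ∈ minElts D S ↔ a ∈ S ∧ ∀ b ∈ S, ¬ D b a := by
  classical simp [minElts]

lemma mem_upSet {D : α → α → Prop} {S : Finset α} {a b : α} :
    b ∈ upSet D S a ↔ b ∈ S ∧ (b = a ∨ D a b) := by
  classical simp [upSet]

lemma finite_linExts (D : α → α → Prop) (S : Finset α) (n : ℕ) :
    Finite (linExts D S n) := by
  have h : {f : Fin n → α | ∀ i, f i ∈ (S : Set α)}.Finite :=
    Set.Finite.pi' fun _ => S.finite_toSet
  refine (h.subset ?_).to_subtype
  rintro f ⟨-, hf, -⟩ i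
  exact hf ▸ Set.mem_range_self i

open scoped Classical in
lemma cons_mem_linExts {D : α → α → Prop} (hirr : ∀ a, ¬ D a a) {S : Finset α} {n : ℕ}
    {a : α} {g : Fin n → α} :
    (Fin.cons a g : Fin (n + 1) → α) ∈ linExts D S (n + 1) ↔
      a ∈ minElts D S ∧ g ∈ linExts D (S.erase a) n := by
  simp only [linExts, Set.mem_ofPred_eq, Fin.cons_injective_iff, Fin.range_cons, mem_minElts,
    Fin.forall_fin_succ, Fin.cons_zero, Fin.cons_succ, Finset.coe_erase, Fin.succ_lt_succ_iff,
    Fin.succ_pos, implies_true, Fin.not_lt_zero, imp_false]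
  constructor
  · rintro ⟨⟨ha, hg⟩, hS, -, hD⟩
    have haS : a ∈ S := by
      rw [← Finset.mem_coe, ← hS]; exact Set.mem_insert _ _
    refine ⟨⟨haS, fun b hb hba => ?_⟩, hg, ?_, fun i => (hD i).2⟩
    · rw [← Finset.mem_coe, ← hS] at hb
      rcases hb with rfl | ⟨i, rfl⟩
      · exact hirr _ hba
      · exact (hD i).1 hba
    · rw [← hS, Set.insert_sdiff_self_of_notMem ha]
  · rintro ⟨⟨haS, hmin⟩, hg, hS, hD⟩
    have hsub : ∀ i, g i ∈ (S : Set α) \ {a} := fun i => hS ▸ Set.mem_range_self i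
    refine ⟨⟨?_, hg⟩, ?_, ⟨hirr a, trivial⟩, fun i => ⟨hmin _ (hsub i).1, hD i⟩⟩
    · rw [hS]; simp
    · rw [hS]; simpa using haS

open scoped Classical in
lemma card_linExts_succ {D : α → α → Prop} (hirr : ∀ a, ¬ D a a) (S : Finset α) (n : ℕ) :
    Nat.card (linExts D S (n + 1)) =
      ∑ a ∈ minElts D S, Nat.card (linExts D (S.erase a) n) := by
  have e : linExts D S (n + 1) ≃
      Σ a : minElts D S, linExts D (S.erase (a : α)) n :=
    { toFun := fun f =>
        have h := (cons_mem_linExts hirr (a := f.1 0) (g := Fin.tail f.1)).1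
          (by rw [Fin.cons_self_tail]; exact f.2)
        ⟨⟨f.1 0, h.1⟩, ⟨Fin.tail f.1, h.2⟩⟩
      invFun := fun x => ⟨Fin.cons x.1.1 x.2.1, (cons_mem_linExts hirr).2 ⟨x.1.2, x.2.2⟩⟩
      left_inv := fun f => Subtype.ext (Fin.cons_self_tail _)
      right_inv := fun _ => rfl }
  have := fun a : minElts D S => finite_linExts D (S.erase (a : α)) n
  rw [Nat.card_congr e, Nat.card_sigma,
    Finset.sum_coe_sort (minElts D S) fun a => Nat.card (linExts D (S.erase a) n)]

/-- In a forest order, the up-sets of the minimal elements partition the whole set. -/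
lemma sum_card_upSet_minElts {D : α → α → Prop} (hirr : ∀ a, ¬ D a a)
    (htrans : ∀ a b c, D a b → D b c → D a c)
    (hchain : ∀ a b c, D a c → D b c → a = b ∨ D a b ∨ D b a) (S : Finset α) :
    ∑ a ∈ minElts D S, (upSet D S a).card = S.card := by
  classical
  rw [← Finset.card_biUnion]
  · congr 1
    ext b
    simp only [Finset.mem_biUnion, mem_upSet, mem_minElts]
    refine ⟨fun ⟨_, _, hb, _⟩ => hb, fun hb => ?_⟩
    have : IsStrictOrder α D := { irrefl := hirr, trans := htrans }
    have hwf : (S : Set α).WellFoundedOn D := S.finite_toSet.wellFoundedOn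
    refine hwf.induction (P := fun b => ∃ a, (a ∈ S ∧ ∀ c ∈ S, ¬ D c a) ∧ b ∈ S ∧
      (b = a ∨ D a b)) hb fun b hb ih => ?_
    by_cases hmin : ∀ c ∈ S, ¬ D c b
    · exact ⟨b, ⟨hb, hmin⟩, hb, Or.inl rfl⟩
    · push Not at hmin
      obtain ⟨c, hc, hcb⟩ := hmin
      obtain ⟨a, ha, -, hac⟩ := ih c hc hcb
      refine ⟨a, ha, hb, Or.inr ?_⟩
      rcases hac with rfl | hac
      exacts [hcb, htrans _ _ _ hac hcb]
  · intro a ha a' ha' hne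
    rw [Function.onFun, Finset.disjoint_left]
    intro b hb hb'
    rw [Finset.mem_coe, mem_minElts] at ha ha'
    rw [mem_upSet] at hb hb'
    have h1 := ha.2 a' ha'.1
    have h2 := ha'.2 a ha.1
    rcases hb.2 with rfl | h
    · rcases hb'.2 with rfl | h'
      · exact hne rfl
      · exact h1 h'
    · rcases hb'.2 with rfl | h'
      · exact h2 h
      · rcases hchain _ _ _ h h' with h | h | h
        exacts [hne h, h2 h, h1 h]

/-- The hook length formula for forest orders. -/
theorem card_linExts_mul_prod_card_upSet {D : α → α → Prop} (hirr : ∀ a, ¬ D a a)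
    (htrans : ∀ a b c, D a b → D b c → D a c)
    (hchain : ∀ a b c, D a c → D b c → a = b ∨ D a b ∨ D b a) (n : ℕ) (S : Finset α)
    (hS : S.card = n) :
    Nat.card (linExts D S n) * ∏ a ∈ S, (upSet D S a).card = n.factorial := by
  classical
  induction n generalizing S with
  | zero =>
    obtain rfl := Finset.card_eq_zero.1 hS
    have : linExts D (∅ : Finset α) 0 = Set.univ := by
      ext f
      simp [linExts, Function.injective_of_subsingleton]
    simp [this]
  | succ n ih =>
    rw [card_linExts_succ hirr, Finset.sum_mul, Nat.factorial_succ, ← hS,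
      ← sum_card_upSet_minElts hirr htrans hchain S, Finset.sum_mul]
    refine Finset.sum_congr rfl fun a ha => ?_
    obtain ⟨haS, hmin⟩ := mem_minElts.1 ha
    rw [← ih (S.erase a) (by rw [Finset.card_erase_of_mem haS, hS]; rfl),
      ← Finset.mul_prod_erase S _ haS]
    have : ∏ b ∈ S.erase a, (upSet D S b).card =
        ∏ b ∈ S.erase a, (upSet D (S.erase a) b).card := by
      refine Finset.prod_congr rfl fun b hb => congrArg Finset.card ?_
      ext c
      have hba := hmin b (Finset.mem_of_mem_erase hb)
      have hne := Finset.ne_of_mem_erase hb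
      simp only [mem_upSet, Finset.mem_erase]
      grind
    rw [this]
    ring

end LinearExtensions

section Downstream

variable {V : Type} {r : V}

/-- A walk through an edge `e` has a strictly shorter final segment starting at an endpoint
of `e`. -/
lemma exists_shorter_walk_of_mem_edges {G : SimpleGraph V} {e : Sym2 V} {v : V}
    (p : G.Walk v r) (he : e ∈ p.edges) :
    ∃ x ∈ e, ∃ q : G.Walk x r, q.length < p.length ∧ q.edges ⊆ p.edges := by
  induction p with
  | nil => simp at he
  | cons h q ih =>
    rw [Walk.edges_cons, List.mem_cons] at he
    rcases he with rfl | he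
    · exact ⟨_, Sym2.mem_mk_right _ _, q, by simp, by simp⟩
    · obtain ⟨x, hx, q', hlen, hsub⟩ := ih he
      refine ⟨x, hx, q', by rw [Walk.length_cons]; omega, ?_⟩
      rw [Walk.edges_cons]
      exact fun a ha => List.mem_cons_of_mem _ (hsub ha)

variable {T : Set (Sym2 V)}

lemma Downstream.not_symm (hconn : ConnFrom r T) {a b : Sym2 V} (hab : Downstream r T a b) :
    ¬ Downstream r T b a := by
  intro hba
  have key : ∀ n, ∀ v, (v ∈ a ∨ v ∈ b) → ∀ p : (fromEdgeSet T).Walk v r, p.length ≠ n := by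
    intro n
    induction n using Nat.strong_induction_on with
    | _ n ih =>
      rintro v (hv | hv) p rfl
      · obtain ⟨x, hx, q, hq, -⟩ := exists_shorter_walk_of_mem_edges p (hba.2.2 v hv p)
        exact ih _ hq x (Or.inr hx) q rfl
      · obtain ⟨x, hx, q, hq, -⟩ := exists_shorter_walk_of_mem_edges p (hab.2.2 v hv p)
        exact ih _ hq x (Or.inl hx) q rfl
  obtain ⟨p⟩ := hconn a hba.1 _ a.out_fst_mem
  exact key _ _ (Or.inl a.out_fst_mem) p.reverse rfl

lemma Downstream.trans (hconn : ConnFrom r T) {a b c : Sym2 V} (hab : Downstream r T a b)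
    (hbc : Downstream r T b c) : Downstream r T a c := by
  refine ⟨hbc.1, ?_, fun v hv p => ?_⟩
  · rintro rfl
    exact hab.not_symm hconn hbc
  · obtain ⟨x, hx, q, -, hq⟩ := exists_shorter_walk_of_mem_edges p (hbc.2.2 v hv p)
    exact hq (hab.2.2 x hx q)

/-- Every edge other than `e` on a path from an endpoint of `e` to the root has `e`
downstream of it. -/
lemma downstream_of_mem_edges_isPath (hdiag : ∀ e ∈ T, ¬ e.IsDiag)
    (hacyclic : (fromEdgeSet T).IsAcyclic) {a e : Sym2 V} (he : e ∈ T) {v : V} (hv : v ∈ e)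
    {p : (fromEdgeSet T).Walk v r} (hp : p.IsPath) (ha : a ∈ p.edges) (hne : a ≠ e) :
    Downstream r T a e := by
  classical
  have hwalk : ∀ q : (fromEdgeSet T).Walk v r, a ∈ q.edges := fun q => by
    have h : p = q.toPath := congrArg Subtype.val ((hacyclic.subsingleton_path v r).elim ⟨p, hp⟩ q.toPath)
    rw [h] at ha
    exact q.edges_toPath_subset_edges ha
  refine ⟨he, hne.symm, fun u hu q => ?_⟩
  obtain ⟨w, rfl⟩ := hv
  have hadj : (fromEdgeSet T).Adj v w := by
    rw [fromEdgeSet_adj]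
    exact ⟨he, fun h => hdiag _ he h⟩
  rcases Sym2.mem_iff.1 hu with rfl | rfl
  · exact hwalk q
  · have := hwalk (Walk.cons hadj q)
    rw [Walk.edges_cons, List.mem_cons] at this
    exact this.resolve_left hne

lemma eq_or_downstream_of_mem_edges (hdiag : ∀ e ∈ T, ¬ e.IsDiag)
    (hacyclic : (fromEdgeSet T).IsAcyclic) {a b : Sym2 V} {v : V}
    (p : (fromEdgeSet T).Walk v r) (hp : p.IsPath) (ha : a ∈ p.edges) (hb : b ∈ p.edges) :
    a = b ∨ Downstream r T a b ∨ Downstream r T b a := by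
  induction p with
  | nil => simp at ha
  | cons h q ih =>
    have hT := ((fromEdgeSet_adj _).1 h).1
    by_cases hab : a = b
    · exact Or.inl hab
    rcases List.mem_cons.1 (Walk.edges_cons h q ▸ ha) with rfl | ha'
    · exact Or.inr (Or.inr (downstream_of_mem_edges_isPath hdiag hacyclic hT
        (Sym2.mem_mk_left _ _) hp hb (Ne.symm hab)))
    rcases List.mem_cons.1 (Walk.edges_cons h q ▸ hb) with rfl | hb'
    · exact Or.inr (Or.inl (downstream_of_mem_edges_isPath hdiag hacyclic hT
        (Sym2.mem_mk_left _ _) hp ha hab))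
    exact ih hp.of_cons ha' hb'

lemma ConnFrom.exists_isPath (hconn : ConnFrom r T) {e : Sym2 V} (he : e ∈ T) {v : V}
    (hv : v ∈ e) : ∃ p : (fromEdgeSet T).Walk v r, p.IsPath := by
  classical
  obtain ⟨p⟩ := hconn e he v hv
  exact ⟨p.reverse.toPath, p.reverse.toPath.2⟩

lemma Downstream.eq_or_comparable (hdiag : ∀ e ∈ T, ¬ e.IsDiag) (hconn : ConnFrom r T)
    (hacyclic : (fromEdgeSet T).IsAcyclic) {a b c : Sym2 V} (hac : Downstream r T a c)
    (hbc : Downstream r T b c) : a = b ∨ Downstream r T a b ∨ Downstream r T b a := by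
  obtain ⟨p, hp⟩ := hconn.exists_isPath hac.1 c.out_fst_mem
  exact eq_or_downstream_of_mem_edges hdiag hacyclic p hp
    (hac.2.2 _ c.out_fst_mem p) (hbc.2.2 _ c.out_fst_mem p)

lemma edges_subset_of_walk_fromEdgeSet {v w : V} (p : (fromEdgeSet T).Walk v w) {e : Sym2 V}
    (he : e ∈ p.edges) : e ∈ T := by
  have := p.edges_subset_edgeSet he
  rw [edgeSet_fromEdgeSet] at this
  exact this.1

/-- Growth sequences are the linear extensions of the downstream order. -/
lemma growthSeqs_eq_linExts {T : Finset (Sym2 V)} (hdiag : ∀ e ∈ T, ¬ e.IsDiag)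
    (hconn : ConnFrom r (T : Set (Sym2 V)))
    (hacyclic : (fromEdgeSet (T : Set (Sym2 V))).IsAcyclic) (L : ℕ) :
    growthSeqs r (T : Set (Sym2 V)) L = linExts (Downstream r T) T L := by
  ext f
  refine and_congr_right fun hinj => and_congr_right fun hrange => ?_
  constructor
  · intro h i j hD
    by_contra! hji
    obtain ⟨p⟩ := h j (f j) ⟨j, le_refl j, rfl⟩ _ (f j).out_fst_mem
    have hle : fromEdgeSet (f '' {i | i ≤ j}) ≤ fromEdgeSet (T : Set (Sym2 V)) :=
      fromEdgeSet_mono (hrange ▸ Set.image_subset_range _ _)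
    have hmem := hD.2.2 _ (f j).out_fst_mem (p.reverse.mapLe hle)
    rw [Walk.edges_mapLe_eq_edges] at hmem
    obtain ⟨k, hk, hki⟩ := edges_subset_of_walk_fromEdgeSet _ hmem
    obtain rfl := hinj hki
    exact hD.2.1 (congrArg f (le_antisymm hji hk))
  · rintro h k e ⟨j, hj, rfl⟩ v hv
    have hjT : f j ∈ (T : Set (Sym2 V)) := hrange ▸ Set.mem_range_self j
    obtain ⟨p, hp⟩ := hconn.exists_isPath hjT hv
    have hedges : ∀ a ∈ p.edges, a ∈ (fromEdgeSet (f '' {i | i ≤ k})).edgeSet := by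
      intro a ha
      have haT := edges_subset_of_walk_fromEdgeSet p ha
      rw [edgeSet_fromEdgeSet]
      refine ⟨?_, hdiag a haT⟩
      by_cases hne : a = f j
      · exact ⟨j, hj, hne.symm⟩
      have hD := downstream_of_mem_edges_isPath hdiag hacyclic hjT hv hp ha hne
      rw [← hrange] at haT
      obtain ⟨i, rfl⟩ := haT
      exact ⟨i, (h i j hD).le.trans hj, rfl⟩
    exact ⟨(p.transfer _ hedges).reverse⟩

lemma wEdge_eq_card_upSet {T : Finset (Sym2 V)} {e : Sym2 V} (he : e ∈ T) :
    wEdge r (T : Set (Sym2 V)) e = (upSet (Downstream r T) T e).card := by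
  classical
  have hset : {e' | Downstream r (T : Set (Sym2 V)) e e'} =
      ↑((upSet (Downstream r T) T e).erase e) := by
    ext e'
    simp only [Set.mem_ofPred_eq, Finset.coe_erase, Set.mem_sdiff, Finset.mem_coe, mem_upSet,
      Set.mem_singleton_iff]
    exact ⟨fun h => ⟨⟨h.1, Or.inr h⟩, h.2.1⟩, fun h => h.1.2.resolve_left h.2⟩
  rw [wEdge, hset, Nat.card_coe_set_eq, Set.ncard_coe_finset, add_comm,
    Finset.card_erase_add_one (mem_upSet.2 ⟨he, Or.inl rfl⟩)]

end Downstream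

/-- For every finite rooted tree `T` with `L` edges,
`N(T) · W(T) = L!`. -/
theorem growth_count_mul_weight_eq_factorial {V : Type} (r : V)
    (T : Finset (Sym2 V)) (L : ℕ) (hL : T.card = L)
    (hdiag : ∀ e ∈ T, ¬ e.IsDiag)
    (hconn : ConnFrom r (↑T : Set (Sym2 V)))
    (hacyclic : (SimpleGraph.fromEdgeSet (↑T : Set (Sym2 V))).IsAcyclic)
    (hroot : T.Nonempty → ∃ e ∈ T, r ∈ e) :
    Ngrowth r (↑T) L * Wtree r T = L.factorial := by
  rw [Ngrowth, growthSeqs_eq_linExts hdiag hconn hacyclic, Wtree,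
    Finset.prod_congr rfl fun e he => wEdge_eq_card_upSet he]
  exact card_linExts_mul_prod_card_upSet (D := Downstream r T) (fun _ h => h.2.1 rfl)
    (fun _ _ _ => Downstream.trans hconn)
    (fun _ _ _ => Downstream.eq_or_comparable hdiag hconn hacyclic) L T hL
end

section
/- Let L ≥ 2 be even and let T be the comb tree on ℤ² with root (0,0), consisting of the L/2 horizontal edges {(i,0),(i+1,0)} for 0 ≤ i ≤ L/2 − 1 and the L/2 vertical edges {(i,0),(i,1)} for 1 ≤ i ≤ L/2. Then N(T) = (L−1)!! (the double factorial 1·3·5⋯(L−1)); in particular N(T) ≥ (L/2)!. -/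
open SimpleGraph

/-- The comb tree on `ℤ²` with `L` bonds (`L` even): the `L/2` horizontal edges
`{(i,0),(i+1,0)}` for `0 ≤ i ≤ L/2 - 1` and the `L/2` vertical edges
`{(i,0),(i,1)}` for `1 ≤ i ≤ L/2`. -/
def comb (L : ℕ) : Set (Sym2 (ℤ × ℤ)) :=
  {e | ∃ i : ℕ, i < L / 2 ∧ e = s(((i : ℤ), 0), ((i : ℤ) + 1, 0))} ∪
  {e | ∃ i : ℕ, 1 ≤ i ∧ i ≤ L / 2 ∧ e = s(((i : ℤ), 0), ((i : ℤ), 1))}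

/-- Enumerations `f` of `T \ S` such that `S` together with any nonempty prefix of `f`
satisfies `P`. -/
def extensionSeqs {α : Type} (P : Set α → Prop) (T S : Set α) (m : ℕ) : Set (Fin m → α) :=
  {f | Function.Injective f ∧ Disjoint S (Set.range f) ∧ S ∪ Set.range f = T ∧
    ∀ k : Fin m, P (S ∪ f '' {i | i ≤ k})}

theorem growthSeqs_eq_extensionSeqs {V : Type} (r : V) (T : Set (Sym2 V)) (L : ℕ) :
    growthSeqs r T L = extensionSeqs (ConnFrom r) T ∅ L := by
  ext f
  simp [growthSeqs, extensionSeqs]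

theorem cons_mem_extensionSeqs {α : Type} {P : Set α → Prop} {T S : Set α} {m : ℕ} {e : α}
    {g : Fin m → α} :
    (Fin.cons e g : Fin (m + 1) → α) ∈ extensionSeqs P T S (m + 1) ↔
      (e ∉ S ∧ P (insert e S)) ∧ g ∈ extensionSeqs P T (insert e S) m := by
  have hzero : (Fin.cons e g : Fin (m + 1) → α) '' {i | i ≤ 0} = {e} := by
    ext x
    simp [eq_comm]
  have hsucc (k : Fin m) : (Fin.cons e g : Fin (m + 1) → α) '' {i | i ≤ k.succ} =
      insert e (g '' {i | i ≤ k}) := by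
    ext x
    simp [Fin.exists_fin_succ, eq_comm]
  simp only [extensionSeqs, Set.mem_ofPred_eq, Fin.cons_injective_iff, Fin.range_cons,
    Fin.forall_fin_succ, hzero, hsucc, Set.union_singleton, Set.union_insert, Set.insert_union,
    Set.disjoint_insert_left, Set.disjoint_insert_right]
  tauto

theorem finite_extensionSeqs {α : Type} (P : Set α → Prop) {T : Set α} (hT : T.Finite)
    (S : Set α) (m : ℕ) : (extensionSeqs P T S m).Finite := by
  refine (Set.Finite.pi' (fun _ : Fin m => hT)).subset ?_
  rintro f ⟨-, -, rfl, -⟩ i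
  exact Or.inr ⟨i, rfl⟩

/-- The number of extensions, obtained by summing over the first element. -/
theorem card_extensionSeqs_succ {α : Type} (P : Set α → Prop) {T : Set α} (hT : T.Finite)
    (S : Set α) (m : ℕ) (C : Finset α)
    (hC : ∀ e, e ∈ C ↔ e ∈ T ∧ e ∉ S ∧ P (insert e S)) :
    Nat.card (extensionSeqs P T S (m + 1)) =
      ∑ e ∈ C, Nat.card (extensionSeqs P T (insert e S) m) := by
  have mem_iff (f : Fin (m + 1) → α) : f ∈ extensionSeqs P T S (m + 1) ↔
      f 0 ∈ C ∧ Fin.tail f ∈ extensionSeqs P T (insert (f 0) S) m := by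
    conv_lhs => rw [← Fin.cons_self_tail f, cons_mem_extensionSeqs]
    rw [hC]
    constructor
    · rintro ⟨h, hg⟩
      exact ⟨⟨hg.2.2.1 ▸ Or.inl (Set.mem_insert _ _), h⟩, hg⟩
    · rintro ⟨⟨-, h⟩, hg⟩
      exact ⟨h, hg⟩
  let φ : extensionSeqs P T S (m + 1) ≃ Σ e : C, extensionSeqs P T (insert e.1 S) m :=
    { toFun := fun f => ⟨⟨f.1 0, ((mem_iff _).1 f.2).1⟩, ⟨Fin.tail f.1, ((mem_iff _).1 f.2).2⟩⟩
      invFun := fun x => ⟨Fin.cons x.1.1 x.2.1, (mem_iff _).2 ⟨x.1.2, x.2.2⟩⟩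
      left_inv := fun f => Subtype.ext (Fin.cons_self_tail f.1)
      right_inv := fun _ => rfl }
  have (e : C) : Finite (extensionSeqs P T (insert e.1 S) m) := finite_extensionSeqs P hT _ m
  rw [Nat.card_congr φ, Nat.card_sigma,
    Finset.sum_coe_sort C fun e => Nat.card (extensionSeqs P T (insert e S) m)]

/-- The horizontal edge from `(i, 0)` to `(i + 1, 0)`. -/
def spineEdge (i : ℕ) : Sym2 (ℤ × ℤ) := s(((i : ℤ), 0), ((i : ℤ) + 1, 0))

/-- The vertical edge from `(i, 0)` to `(i, 1)`. -/
def toothEdge (i : ℕ) : Sym2 (ℤ × ℤ) := s(((i : ℤ), 0), ((i : ℤ), 1))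

theorem spineEdge_injective : Function.Injective spineEdge := by
  intro i j h
  simp only [spineEdge, Sym2.eq_iff, Prod.mk.injEq] at h
  omega

theorem toothEdge_injective : Function.Injective toothEdge := by
  intro i j h
  simp only [toothEdge, Sym2.eq_iff, Prod.mk.injEq] at h
  omega

theorem spineEdge_ne_toothEdge (i j : ℕ) : spineEdge i ≠ toothEdge j := by
  intro h
  simp only [spineEdge, toothEdge, Sym2.eq_iff, Prod.mk.injEq] at h
  omega

/-- The first `p` spine edges together with the teeth at the positions in `A`. -/
def partialComb (p : ℕ) (A : Finset ℕ) : Set (Sym2 (ℤ × ℤ)) :=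
  spineEdge '' Set.Iio p ∪ toothEdge '' A

theorem spineEdge_mem_partialComb {p i : ℕ} {A : Finset ℕ} :
    spineEdge i ∈ partialComb p A ↔ i < p := by
  simp [partialComb, spineEdge_injective.eq_iff, (spineEdge_ne_toothEdge _ _).symm]

theorem toothEdge_mem_partialComb {p i : ℕ} {A : Finset ℕ} :
    toothEdge i ∈ partialComb p A ↔ i ∈ A := by
  simp [partialComb, toothEdge_injective.eq_iff, spineEdge_ne_toothEdge]

theorem comb_eq_partialComb (L : ℕ) : comb L = partialComb (L / 2) (Finset.Icc 1 (L / 2)) := by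
  ext e
  simp [comb, partialComb, spineEdge, toothEdge, eq_comm, and_assoc]

theorem finite_partialComb (p : ℕ) (A : Finset ℕ) : (partialComb p A).Finite :=
  ((Set.finite_Iio p).image _).union (A.finite_toSet.image _)

theorem insert_spineEdge (p : ℕ) (A : Finset ℕ) :
    insert (spineEdge p) (partialComb p A) = partialComb (p + 1) A := by
  rw [partialComb, partialComb, ← Set.insert_union, ← Set.image_insert_eq]
  congr 2
  ext i
  simp only [Set.mem_insert_iff, Set.mem_Iio]
  omega

theorem insert_toothEdge (p i : ℕ) (A : Finset ℕ) :
    insert (toothEdge i) (partialComb p A) = partialComb p (insert i A) := by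
  rw [partialComb, partialComb, ← Set.union_insert, ← Set.image_insert_eq, Finset.coe_insert]

theorem connFrom_partialComb {p : ℕ} {A : Finset ℕ} (hA : A ⊆ Finset.Icc 1 p) :
    ConnFrom (0, 0) (partialComb p A) := by
  have spine (i : ℕ) (hi : i ≤ p) :
      (SimpleGraph.fromEdgeSet (partialComb p A)).Reachable (0, 0) ((i : ℤ), 0) := by
    induction i with
    | zero => exact .rfl
    | succ i ih =>
      refine (ih (by omega)).trans (SimpleGraph.Adj.reachable ?_)
      rw [SimpleGraph.fromEdgeSet_adj]
      refine ⟨?_, by simp⟩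
      have := (spineEdge_mem_partialComb (A := A)).2 (show i < p by omega)
      simpa [spineEdge] using this
  rintro e (⟨i, hi, rfl⟩ | ⟨i, hi, rfl⟩) v hv
  · rw [Set.mem_Iio] at hi
    rcases Sym2.mem_iff.1 hv with rfl | rfl
    · exact spine i hi.le
    · exact_mod_cast spine (i + 1) hi
  · have hip := (Finset.mem_Icc.1 (hA hi)).2
    rcases Sym2.mem_iff.1 hv with rfl | rfl
    · exact spine i hip
    · refine (spine i hip).trans (SimpleGraph.Adj.reachable ?_)
      rw [SimpleGraph.fromEdgeSet_adj]
      exact ⟨(toothEdge_mem_partialComb (p := p)).2 hi, by simp⟩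

/-- A partial comb cannot be connected to an edge all of whose endpoints lie beyond its spine. -/
theorem not_connFrom_insert {p : ℕ} {A : Finset ℕ} (hA : A ⊆ Finset.Icc 1 p)
    {e : Sym2 (ℤ × ℤ)} (he : ∀ v ∈ e, (p : ℤ) < v.1) :
    ¬ ConnFrom (0, 0) (insert e (partialComb p A)) := by
  intro h
  have step (u w : ℤ × ℤ)
      (huw : (SimpleGraph.fromEdgeSet (insert e (partialComb p A))).Adj u w)
      (hu : u.1 ≤ p) : w.1 ≤ p := by
    rw [SimpleGraph.fromEdgeSet_adj] at huw
    rcases huw.1 with rfl | ⟨i, hi, hiuw⟩ | ⟨i, hi, hiuw⟩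
    · exact absurd (he u (Sym2.mem_mk_left u w)) (not_lt.2 hu)
    · rw [Set.mem_Iio] at hi
      rcases Sym2.eq_iff.1 hiuw with ⟨rfl, rfl⟩ | ⟨rfl, rfl⟩ <;> dsimp only <;> omega
    · have hip := (Finset.mem_Icc.1 (hA hi)).2
      rcases Sym2.eq_iff.1 hiuw with ⟨rfl, rfl⟩ | ⟨rfl, rfl⟩ <;> dsimp only <;> omega
  have reach (u w : ℤ × ℤ)
      (q : (SimpleGraph.fromEdgeSet (insert e (partialComb p A))).Walk u w)
      (hu : u.1 ≤ p) : w.1 ≤ p := by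
    induction q with
    | nil => exact hu
    | cons hadj _ ih => exact ih (step _ _ hadj hu)
  obtain ⟨v, hv⟩ : ∃ v, v ∈ e := ⟨_, Sym2.out_fst_mem e⟩
  obtain ⟨q⟩ := h e (Set.mem_insert _ _) v hv
  exact absurd (he v hv) (not_lt.2 (reach _ _ q (by simp)))

/-- The edges by which a partial comb can grow. -/
theorem mem_growth_candidates {n p : ℕ} {A : Finset ℕ} (hp : p ≤ n) (hA : A ⊆ Finset.Icc 1 p)
    (e : Sym2 (ℤ × ℤ)) :
    e ∈ (Finset.Ico p (min n (p + 1))).image spineEdge ∪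
        (Finset.Icc 1 p \ A).image toothEdge ↔
      e ∈ partialComb n (Finset.Icc 1 n) ∧ e ∉ partialComb p A ∧
        ConnFrom (0, 0) (insert e (partialComb p A)) := by
  simp only [Finset.mem_union, Finset.mem_image, Finset.mem_Ico, lt_min_iff, Finset.mem_sdiff]
  constructor
  · rintro (⟨i, ⟨hpi, hin, hip⟩, rfl⟩ | ⟨i, ⟨hi, hiA⟩, rfl⟩)
    · obtain rfl : i = p := by omega
      refine ⟨spineEdge_mem_partialComb.2 hin, fun h => ?_, ?_⟩
      · exact lt_irrefl _ (spineEdge_mem_partialComb.1 h)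
      · rw [insert_spineEdge]
        exact connFrom_partialComb (hA.trans (Finset.Icc_subset_Icc_right (by omega)))
    · refine ⟨toothEdge_mem_partialComb.2 (Finset.Icc_subset_Icc_right hp hi),
        fun h => hiA (toothEdge_mem_partialComb.1 h), ?_⟩
      rw [insert_toothEdge]
      exact connFrom_partialComb (Finset.insert_subset hi hA)
  · rintro ⟨⟨i, hi, rfl⟩ | ⟨i, hi, rfl⟩, hnot, hconn⟩
    · rw [spineEdge_mem_partialComb] at hnot
      rw [Set.mem_Iio] at hi
      refine Or.inl ⟨i, ⟨by omega, hi, ?_⟩, rfl⟩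
      by_contra hip
      refine not_connFrom_insert hA (fun v hv => ?_) hconn
      rcases Sym2.mem_iff.1 hv with rfl | rfl <;> dsimp only <;> omega
    · rw [toothEdge_mem_partialComb] at hnot
      have hi1 := (Finset.mem_Icc.1 hi).1
      refine Or.inr ⟨i, ⟨Finset.mem_Icc.2 ⟨hi1, ?_⟩, hnot⟩, rfl⟩
      by_contra hip
      refine not_connFrom_insert hA (fun v hv => ?_) hconn
      rcases Sym2.mem_iff.1 hv with rfl | rfl <;> dsimp only <;> omega

/-- The number of ways to grow a partial comb into the comb with `n` teeth. -/
theorem card_extensionSeqs_partialComb (n m : ℕ) : ∀ (p : ℕ) (A : Finset ℕ), p ≤ n →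
    A ⊆ Finset.Icc 1 p → m + A.card + p = 2 * n →
    Nat.card (extensionSeqs (ConnFrom (0, 0)) (partialComb n (Finset.Icc 1 n))
      (partialComb p A) m) * (2 ^ (n - p) * (n - p).factorial) = m.factorial := by
  induction m with
  | zero =>
    intro p A hp hA hm
    have hcard := Finset.card_le_card hA
    rw [Nat.card_Icc] at hcard
    obtain rfl : p = n := by omega
    obtain rfl : A = Finset.Icc 1 p :=
      Finset.eq_of_subset_of_card_le hA (by rw [Nat.card_Icc]; omega)
    have : extensionSeqs (ConnFrom (0, 0)) (partialComb p (Finset.Icc 1 p))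
        (partialComb p (Finset.Icc 1 p)) 0 = Set.univ := by
      ext f
      simp [extensionSeqs, Function.injective_of_subsingleton]
    simp [this]
  | succ m ih =>
    intro p A hp hA hm
    have hdisj : Disjoint ((Finset.Ico p (min n (p + 1))).image spineEdge)
        ((Finset.Icc 1 p \ A).image toothEdge) := by
      simp only [Finset.disjoint_left, Finset.mem_image]
      rintro _ ⟨i, -, rfl⟩ ⟨j, -, h⟩
      exact spineEdge_ne_toothEdge i j h.symm
    have hcard : (Finset.Icc 1 p \ A).card + A.card = p := by
      rw [Finset.card_sdiff_add_card_eq_card hA, Nat.card_Icc, Nat.add_sub_cancel]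
    have tooth : ∀ i ∈ Finset.Icc 1 p \ A,
        Nat.card (extensionSeqs (ConnFrom (0, 0)) (partialComb n (Finset.Icc 1 n))
          (insert (toothEdge i) (partialComb p A)) m) *
          (2 ^ (n - p) * (n - p).factorial) = m.factorial := by
      intro i hi
      rw [Finset.mem_sdiff] at hi
      rw [insert_toothEdge]
      refine ih p _ hp (Finset.insert_subset hi.1 hA) ?_
      rw [Finset.card_insert_of_notMem hi.2]
      omega
    rw [card_extensionSeqs_succ _ (finite_partialComb _ _) _ _ _ (mem_growth_candidates hp hA),
      Finset.sum_union hdisj, Finset.sum_image spineEdge_injective.injOn,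
      Finset.sum_image toothEdge_injective.injOn, add_mul, Finset.sum_mul _ _ (2 ^ _ * _),
      Finset.sum_mul (Finset.Icc 1 p \ A), Finset.sum_congr rfl tooth, Finset.sum_const,
      smul_eq_mul]
    rcases hp.eq_or_lt with rfl | hlt
    · rw [min_eq_left (Nat.le_succ p), Finset.Ico_self, Finset.sum_empty, zero_add,
        Nat.factorial_succ]
      congr 1
      omega
    · have spine := ih (p + 1) A hlt
        (hA.trans (Finset.Icc_subset_Icc_right (Nat.le_succ p))) (by omega)
      obtain ⟨a, rfl⟩ : ∃ a, n = p + 1 + a := ⟨n - (p + 1), by omega⟩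
      rw [min_eq_right (by omega), Nat.Ico_succ_singleton, Finset.sum_singleton, insert_spineEdge]
      rw [Nat.add_sub_cancel_left] at spine
      rw [show p + 1 + a - p = a + 1 by omega, Nat.factorial_succ, Nat.factorial_succ, ← spine,
        show m + 1 = 2 * (a + 1) + (Finset.Icc 1 p \ A).card by omega]
      ring

theorem factorial_le_doubleFactorial (n : ℕ) : (n + 1).factorial ≤ (2 * n + 1).doubleFactorial := by
  induction n with
  | zero => simp
  | succ n ih =>
    rw [Nat.factorial_succ, show 2 * (n + 1) + 1 = 2 * n + 1 + 2 by ring,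
      Nat.doubleFactorial_add_two]
    exact Nat.mul_le_mul (by omega) ih

/-- For even `L ≥ 2`, the comb tree with root `(0,0)`
satisfies `N(T) = (L-1)!!`; in particular `N(T) ≥ (L/2)!`. -/
theorem comb_growth_count (L : ℕ) (hL2 : 2 ≤ L) (hLeven : Even L) :
    Ngrowth ((0, 0) : ℤ × ℤ) (comb L) L = Nat.doubleFactorial (L - 1) ∧
    (L / 2).factorial ≤ Ngrowth ((0, 0) : ℤ × ℤ) (comb L) L := by
  obtain ⟨n, rfl⟩ : ∃ n, L = 2 * n + 2 := by
    obtain ⟨k, rfl⟩ := hLeven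
    exact ⟨k - 1, by omega⟩
  have hhalf : (2 * n + 2) / 2 = n + 1 := by omega
  have main : Ngrowth ((0, 0) : ℤ × ℤ) (comb (2 * n + 2)) (2 * n + 2) =
      Nat.doubleFactorial (2 * n + 1) := by
    have key := card_extensionSeqs_partialComb (n + 1) (2 * n + 2) 0 ∅ (Nat.zero_le _)
      (Finset.empty_subset _) (by simp; ring)
    have hempty : partialComb 0 ∅ = ∅ := by
      ext e
      simp [partialComb]
    rw [hempty, Nat.sub_zero, ← Nat.doubleFactorial_two_mul,
      Nat.factorial_eq_mul_doubleFactorial, show 2 * (n + 1) = 2 * n + 1 + 1 by ring] at key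
    rw [Ngrowth, growthSeqs_eq_extensionSeqs, comb_eq_partialComb, hhalf]
    exact Nat.eq_of_mul_eq_mul_right (Nat.doubleFactorial_pos _) (key.trans (mul_comm _ _))
  rw [main, hhalf]
  exact ⟨rfl, factorial_le_doubleFactorial n⟩
end

section
/- Let G be a simple graph that is a tree in which every vertex has degree exactly 3, with a fixed root vertex r. For every L ≥ 1, the number of sequences e_1, …, e_L of pairwise distinct edges of G such that for each k = 1, …, L the edges e_1, …, e_k form a connected subgraph containing r is exactly 3·4·5⋯(L+2) = (L+2)!/2. -/
open SimpleGraph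

/-- The vertices touched by the edge set `S`, together with the root `r`. -/
def touchedVerts {V : Type} (r : V) (S : Set (Sym2 V)) : Set V :=
  {v | v = r ∨ ∃ e ∈ S, v ∈ e}

/-- The edges of `G` outside `S` with an endpoint touched by `S` (or equal to the root). -/
def edgeFrontier {V : Type} (G : SimpleGraph V) (r : V) (S : Set (Sym2 V)) : Set (Sym2 V) :=
  {e | e ∈ G.edgeSet ∧ e ∉ S ∧ ∃ v ∈ e, v ∈ touchedVerts r S}

/-- Sequences of `L` distinct edges of `G` all of whose prefixes are connected and contain `r`. -/
def grownSeqs {V : Type} (G : SimpleGraph V) (r : V) (L : ℕ) : Set (Fin L → Sym2 V) :=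
  {f | Function.Injective f ∧ (∀ i : Fin L, f i ∈ G.edgeSet) ∧
    ∀ k : Fin L, ConnFrom r (f '' {i | i ≤ k})}

section

variable {V : Type} {G : SimpleGraph V} {r : V} {S : Set (Sym2 V)} {e : Sym2 V}

lemma touchedVerts_mono {T : Set (Sym2 V)} (h : S ⊆ T) : touchedVerts r S ⊆ touchedVerts r T := by
  rintro v (hv | ⟨e, he, hv⟩)
  · exact Or.inl hv
  · exact Or.inr ⟨e, h he, hv⟩

lemma ConnFrom.reachable (h : ConnFrom r S) {v : V} (hv : v ∈ touchedVerts r S) :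
    (fromEdgeSet S).Reachable r v := by
  rcases hv with rfl | ⟨e, he, hv⟩
  · exact Reachable.refl _
  · exact h e he v hv

lemma connFrom_insert (h : ConnFrom r S) (he : ∃ v ∈ e, v ∈ touchedVerts r S) :
    ConnFrom r (insert e S) := by
  have hle : fromEdgeSet S ≤ fromEdgeSet (insert e S) :=
    fromEdgeSet_mono (Set.subset_insert e S)
  obtain ⟨v, hve, hv⟩ := he
  obtain ⟨w, rfl⟩ := Sym2.mem_iff_exists.mp hve
  have hrv := (h.reachable hv).mono hle
  rintro e' (rfl | he') x hx
  · rcases Sym2.mem_iff.mp hx with rfl | rfl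
    · exact hrv
    · by_cases hvx : v = x
      · exact hvx ▸ hrv
      · refine hrv.trans (Adj.reachable ?_)
        rw [fromEdgeSet_adj]
        exact ⟨Set.mem_insert _ _, hvx⟩
  · exact (h e' he' x hx).mono hle

lemma exists_mem_touchedVerts_of_connFrom_insert (h : ConnFrom r (insert e S)) :
    ∃ v ∈ e, v ∈ touchedVerts r S := by
  by_contra! hno
  have key : ∀ x y : V, (fromEdgeSet (insert e S)).Walk x y →
      x ∈ touchedVerts r S → y ∈ touchedVerts r S := by
    intro x y p
    induction p with
    | nil => exact id
    | cons hadj _ ih =>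
      intro hx
      rw [fromEdgeSet_adj] at hadj
      rcases hadj.1 with heq | hmem
      · exact absurd hx (hno _ (heq ▸ Sym2.mem_mk_left _ _))
      · exact ih (Or.inr ⟨_, hmem, Sym2.mem_mk_right _ _⟩)
  obtain ⟨v, hv⟩ : ∃ v, v ∈ e := ⟨_, Sym2.out_fst_mem e⟩
  obtain ⟨p⟩ := h e (Set.mem_insert _ _) v hv
  exact hno v hv (key _ _ p (Or.inl rfl))

/-- In an acyclic graph, an edge joining two vertices of a connected edge set belongs to it. -/
lemma SimpleGraph.IsAcyclic.mem_of_mem_touchedVerts (hG : G.IsAcyclic) (hS : S ⊆ G.edgeSet)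
    (h : ConnFrom r S) {v w : V} (hvw : G.Adj v w) (hv : v ∈ touchedVerts r S)
    (hw : w ∈ touchedVerts r S) : s(v, w) ∈ S := by
  by_contra hnot
  have hb := isAcyclic_iff_forall_adj_isBridge.mp hG hvw
  rw [isBridge_iff] at hb
  refine hb (((h.reachable hv).symm.trans (h.reachable hw)).mono ?_)
  intro a b hab
  rw [fromEdgeSet_adj] at hab
  rw [deleteEdges_adj]
  refine ⟨hS hab.1, fun heq => hnot ?_⟩
  rw [← Set.mem_singleton_iff.mp heq]
  exact hab.1

lemma ncard_incidenceSet (v : V) :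
    (G.incidenceSet v).ncard = Nat.card (G.neighborSet v) := by
  classical
  exact Nat.card_congr (G.incidenceSetEquivNeighborSet v)

lemma edgeFrontier_empty : edgeFrontier G r ∅ = G.incidenceSet r := by
  ext e
  simp [edgeFrontier, touchedVerts, incidenceSet]

lemma edgeFrontier_insert (hG : G.IsAcyclic) (hS : S ⊆ G.edgeSet) (h : ConnFrom r S)
    (he : e ∈ edgeFrontier G r S) :
    ∃ w, e ∈ G.incidenceSet w ∧
      edgeFrontier G r (insert e S) = edgeFrontier G r S \ {e} ∪ G.incidenceSet w \ {e} ∧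
      Disjoint (edgeFrontier G r S \ {e}) (G.incidenceSet w \ {e}) := by
  have hcon := connFrom_insert h he.2.2
  obtain ⟨heG, heS, v, hve, hv⟩ := he
  obtain ⟨w, rfl⟩ := Sym2.mem_iff_exists.mp hve
  have hw : w ∉ touchedVerts r S := fun hw => heS (hG.mem_of_mem_touchedVerts hS h heG hv hw)
  have hwS : ∀ e' ∈ S, w ∉ e' := fun e' he' hwe' => hw (Or.inr ⟨e', he', hwe'⟩)
  have hw' : w ∈ touchedVerts r (insert s(v, w) S) :=
    Or.inr ⟨_, Set.mem_insert _ _, Sym2.mem_mk_right _ _⟩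
  have hsub := touchedVerts_mono (r := r) (Set.subset_insert s(v, w) S)
  refine ⟨w, ⟨heG, Sym2.mem_mk_right _ _⟩, ?_, ?_⟩
  · ext e'
    constructor
    · rintro ⟨hG', hn, x, hx, hxt⟩
      rw [Set.mem_insert_iff, not_or] at hn
      have hold : x ∈ touchedVerts r S → e' ∈ edgeFrontier G r S \ {s(v, w)} :=
        fun hxS => ⟨⟨hG', hn.2, x, hx, hxS⟩, hn.1⟩
      rcases hxt with hxr | ⟨e'', rfl | he'', hx''⟩
      · exact Or.inl (hold (Or.inl hxr))
      · rcases Sym2.mem_iff.mp hx'' with rfl | rfl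
        · exact Or.inl (hold hv)
        · exact Or.inr ⟨⟨hG', hx⟩, hn.1⟩
      · exact Or.inl (hold (Or.inr ⟨e'', he'', hx''⟩))
    · rintro (⟨⟨hG', hn, x, hx, hxt⟩, hne⟩ | ⟨⟨hG', hx⟩, hne⟩)
      · exact ⟨hG', fun hm => hm.elim hne hn, x, hx, hsub hxt⟩
      · exact ⟨hG', fun hm => hm.elim hne fun hm' => hwS _ hm' hx, w, hx, hw'⟩
  · rw [Set.disjoint_left]
    rintro e' ⟨⟨hG', hn, x, hx, hxt⟩, hne⟩ ⟨⟨-, hwe'⟩, -⟩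
    obtain ⟨u, rfl⟩ := Sym2.mem_iff_exists.mp hwe'
    have hu : u ∈ touchedVerts r S := by
      rcases Sym2.mem_iff.mp hx with rfl | rfl
      · exact absurd hxt hw
      · exact hxt
    rcases hG.mem_of_mem_touchedVerts (Set.insert_subset heG hS) hcon hG' hw' (hsub hu) with hm | hm
    · exact hne hm
    · exact hn hm

lemma ncard_edgeFrontier_insert (hG : G.IsAcyclic) (hdeg : ∀ v, Nat.card (G.neighborSet v) = 3)
    (hS : S ⊆ G.edgeSet) (h : ConnFrom r S) (he : e ∈ edgeFrontier G r S)
    (hfin : (edgeFrontier G r S).Finite) :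
    (edgeFrontier G r (insert e S)).ncard = (edgeFrontier G r S).ncard + 1 := by
  obtain ⟨w, hew, heq, hdisj⟩ := edgeFrontier_insert hG hS h he
  have hcard : (G.incidenceSet w).ncard = 3 := (ncard_incidenceSet w).trans (hdeg w)
  have hfw : (G.incidenceSet w).Finite := Set.finite_of_ncard_ne_zero (by omega)
  rw [heq, Set.ncard_union_eq hdisj hfin.sdiff hfw.sdiff]
  have h1 := Set.ncard_sdiff_singleton_add_one he hfin
  have h2 := Set.ncard_sdiff_singleton_add_one hew hfw
  omega

lemma connFrom_range_of_mem_grownSeqs {L : ℕ} {f : Fin L → Sym2 V} (hf : f ∈ grownSeqs G r L) :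
    ConnFrom r (Set.range f) := by
  cases L with
  | zero => rintro _ ⟨i, -⟩; exact i.elim0
  | succ n =>
    have h := hf.2.2 (Fin.last n)
    rwa [show {i | i ≤ Fin.last n} = Set.univ from Set.eq_univ_of_forall Fin.le_last,
      Set.image_univ] at h

lemma snoc_image_le_castSucc {L : ℕ} (f : Fin L → Sym2 V) (e : Sym2 V) (k : Fin L) :
    (Fin.snoc f e : Fin (L + 1) → Sym2 V) '' {i | i ≤ k.castSucc} = f '' {i | i ≤ k} := by
  ext x
  simp [Fin.exists_fin_succ', Fin.snoc_castSucc, Fin.snoc_last]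

lemma snoc_mem_grownSeqs_iff {L : ℕ} {f : Fin L → Sym2 V} :
    (Fin.snoc f e : Fin (L + 1) → Sym2 V) ∈ grownSeqs G r (L + 1) ↔
      f ∈ grownSeqs G r L ∧ e ∈ edgeFrontier G r (Set.range f) := by
  constructor
  · intro h
    have hrange := connFrom_range_of_mem_grownSeqs h
    rw [Fin.range_snoc] at hrange
    obtain ⟨hinj, hG, hc⟩ := h
    rw [Fin.snoc_injective_iff] at hinj
    refine ⟨⟨hinj.1, fun i => ?_, fun k => ?_⟩, ?_, hinj.2,
      exists_mem_touchedVerts_of_connFrom_insert hrange⟩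
    · simpa only [Fin.snoc_castSucc] using hG i.castSucc
    · simpa only [snoc_image_le_castSucc] using hc k.castSucc
    · simpa only [Fin.snoc_last] using hG (Fin.last L)
  · rintro ⟨hf, heG, hes, het⟩
    refine ⟨Fin.snoc_injective_iff.mpr ⟨hf.1, hes⟩, fun i => ?_, fun k => ?_⟩
    · refine Fin.lastCases ?_ (fun j => ?_) i
      · simpa only [Fin.snoc_last] using heG
      · simpa only [Fin.snoc_castSucc] using hf.2.1 j
    · refine Fin.lastCases ?_ (fun j => ?_) k
      · rw [show {i | i ≤ Fin.last L} = Set.univ from Set.eq_univ_of_forall Fin.le_last,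
          Set.image_univ, Fin.range_snoc]
        exact connFrom_insert (connFrom_range_of_mem_grownSeqs hf) het
      · rw [snoc_image_le_castSucc]
        exact hf.2.2 j

lemma ncard_edgeFrontier_range (hG : G.IsAcyclic) (hdeg : ∀ v, Nat.card (G.neighborSet v) = 3)
    {L : ℕ} {f : Fin L → Sym2 V} (hf : f ∈ grownSeqs G r L) :
    (edgeFrontier G r (Set.range f)).ncard = L + 3 := by
  induction L with
  | zero => rw [Set.range_eq_empty, edgeFrontier_empty, ncard_incidenceSet, hdeg]
  | succ n ih =>
    rw [← Fin.snoc_init_self f] at hf ⊢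
    obtain ⟨hf', he⟩ := snoc_mem_grownSeqs_iff.mp hf
    have hn := ih hf'
    rw [Fin.range_snoc, ncard_edgeFrontier_insert hG hdeg (Set.range_subset_iff.mpr hf'.2.1)
      (connFrom_range_of_mem_grownSeqs hf') he (Set.finite_of_ncard_ne_zero (by omega)), hn]

/-- A growth sequence of length `L + 1` is one of length `L` followed by a frontier edge. -/
def grownSeqsSuccEquiv (G : SimpleGraph V) (r : V) (L : ℕ) :
    grownSeqs G r (L + 1) ≃ Σ f : grownSeqs G r L, edgeFrontier G r (Set.range f.1) where
  toFun g :=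
    have h := snoc_mem_grownSeqs_iff.mp ((Fin.snoc_init_self g.1).symm ▸ g.2)
    ⟨⟨Fin.init g.1, h.1⟩, ⟨g.1 (Fin.last L), h.2⟩⟩
  invFun p := ⟨Fin.snoc p.1.1 p.2.1, snoc_mem_grownSeqs_iff.mpr ⟨p.1.2, p.2.2⟩⟩
  left_inv g := Subtype.ext (Fin.snoc_init_self g.1)
  right_inv := by
    rintro ⟨⟨f, hf⟩, ⟨e, he⟩⟩
    have h1 : Fin.init (Fin.snoc f e : Fin (L + 1) → Sym2 V) = f := Fin.init_snoc _ _
    have h2 : (Fin.snoc f e : Fin (L + 1) → Sym2 V) (Fin.last L) = e := Fin.snoc_last _ _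
    simp only [Sigma.mk.injEq, h1, true_and]
    congr!

lemma two_mul_card_grownSeqs (hG : G.IsAcyclic) (hdeg : ∀ v, Nat.card (G.neighborSet v) = 3)
    (L : ℕ) : 2 * Nat.card (grownSeqs G r L) = (L + 2).factorial := by
  induction L with
  | zero =>
    have : grownSeqs G r 0 = Set.univ := Set.eq_univ_of_forall fun f =>
      ⟨Function.injective_of_subsingleton f, fun i => i.elim0, fun i => i.elim0⟩
    simp [this]
  | succ n ih =>
    have : Finite (grownSeqs G r n) := by
      have := (n + 2).factorial_pos
      exact Nat.finite_of_card_ne_zero (by omega)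
    have := Fintype.ofFinite (grownSeqs G r n)
    have hfib : ∀ f : grownSeqs G r n, Nat.card (edgeFrontier G r (Set.range f.1)) = n + 3 :=
      fun f => ncard_edgeFrontier_range hG hdeg f.2
    have : ∀ f : grownSeqs G r n, Finite (edgeFrontier G r (Set.range f.1)) :=
      fun f => Nat.finite_of_card_ne_zero (by rw [hfib]; omega)
    rw [Nat.card_congr (grownSeqsSuccEquiv G r n), Nat.card_sigma, Finset.sum_congr rfl
      fun f _ => hfib f, Finset.sum_const, Finset.card_univ, ← Nat.card_eq_fintype_card,
      smul_eq_mul, ← mul_assoc, ih, show n + 1 + 2 = n + 2 + 1 by omega, Nat.factorial_succ (n + 2),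
      mul_comm]

end

/-- Let `G` be a tree in which every vertex has degree exactly
`3`, with fixed root `r`.  For every `L ≥ 1`, the number of sequences
`e_1, …, e_L` of pairwise distinct edges of `G` such that for each `k` the
edges `e_1, …, e_k` form a connected subgraph containing `r` is exactly
`3·4·5⋯(L+2) = (L+2)!/2`. -/
theorem grown_sequences_count {V : Type} (G : SimpleGraph V)
    (htree : G.IsTree) (hdeg : ∀ v : V, Nat.card (G.neighborSet v) = 3)
    (r : V) (L : ℕ) (hL : 1 ≤ L) :
    Nat.card {f : Fin L → Sym2 V | Function.Injective f ∧
      (∀ i : Fin L, f i ∈ G.edgeSet) ∧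
      ∀ k : Fin L, ConnFrom r (f '' {i | i ≤ k})} = (L + 2).factorial / 2 := by
  exact Nat.eq_div_of_mul_eq_right two_ne_zero (two_mul_card_grownSeqs htree.isAcyclic hdeg L)
end

section
/- Let G be a simple graph that is a tree in which every vertex has degree exactly 3, with a fixed root vertex r. For every L ≥ 1, the number of sets T of L edges of G that form a connected subgraph containing r is finite and at most 3^{2L} = 9^L. -/
open SimpleGraph

/-- A walk starting at `r` whose edges form a proper subset of an edge set `T` that is connected
from `r` visits an endpoint of an edge of `T` that it does not traverse. -/
lemma exists_unvisited_edge_of_connFrom {V : Type} {G : SimpleGraph V} {r s : V}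
    {T : Set (Sym2 V)} (hT : ConnFrom r T) (p : G.Walk r s) (hne : ∃ e ∈ T, e ∉ p.edges) :
    ∃ u ∈ p.support, ∃ v, s(u, v) ∈ T ∧ s(u, v) ∉ p.edges := by
  by_contra! hclosed
  have hreach : ∀ {a b : V}, (fromEdgeSet T).Walk a b → a ∈ p.support → b ∈ p.support := by
    intro a b q
    induction q with
    | nil => exact id
    | cons h _ ih =>
      exact fun ha => ih (p.snd_mem_support_of_mem_edges
        (hclosed _ ha _ ((fromEdgeSet_adj T).mp h).1))
  obtain ⟨e, heT, hep⟩ := hne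
  induction e with
  | h x y =>
    obtain ⟨q⟩ := hT _ heT x (Sym2.mem_mk_left x y)
    exact hep (hclosed x (hreach q p.start_mem_support) y heT)

/-- A closed walk can be extended by a detour along an edge at any vertex it visits. -/
lemma exists_closed_walk_with_detour {V : Type} [DecidableEq V] {G : SimpleGraph V} {r u v : V}
    (p : G.Walk r r) (hu : u ∈ p.support) (h : G.Adj u v) :
    ∃ q : G.Walk r r, q.length = p.length + 2 ∧
      q.edges.toFinset = insert s(u, v) p.edges.toFinset := by
  refine ⟨(p.takeUntil u hu).append (.cons h (.cons h.symm (p.dropUntil u hu))), ?_, ?_⟩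
  · have := congrArg Walk.length (p.take_spec hu)
    simp only [Walk.length_append, Walk.length_cons] at this ⊢
    omega
  · have := congrArg Walk.edges (p.take_spec hu)
    rw [Walk.edges_append] at this
    rw [← this]
    ext e
    simp only [Walk.edges_append, Walk.edges_cons, List.mem_toFinset, List.mem_append,
      List.mem_cons, Finset.mem_insert, Sym2.eq_swap (a := v)]
    tauto

/-- A finite edge set connected from `r` is the edge set of a closed walk at `r` of length twice
its number of edges. -/
lemma exists_closed_walk_of_connFrom {V : Type} [DecidableEq V] {G : SimpleGraph V} {r : V}
    {T : Finset (Sym2 V)} (hTG : (T : Set (Sym2 V)) ⊆ G.edgeSet)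
    (hT : ConnFrom r (T : Set (Sym2 V))) :
    ∃ p : G.Walk r r, p.length = 2 * T.card ∧ p.edges.toFinset = T := by
  have hpartial : ∀ n ≤ T.card, ∃ p : G.Walk r r, p.length = 2 * n ∧
      p.edges.toFinset ⊆ T ∧ p.edges.toFinset.card = n := by
    intro n
    induction n with
    | zero => exact fun _ => ⟨.nil, by simp⟩
    | succ n ih =>
      intro hn
      obtain ⟨p, hlen, hsub, hcard⟩ := ih (by omega)
      obtain ⟨e, heT, hep⟩ := Finset.exists_mem_notMem_of_card_lt_card
        (show p.edges.toFinset.card < T.card by omega)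
      obtain ⟨u, hu, v, huvT, huvp⟩ := exists_unvisited_edge_of_connFrom hT p
        ⟨e, heT, by simpa using hep⟩
      obtain ⟨q, hqlen, hqedges⟩ := exists_closed_walk_with_detour p hu (hTG huvT)
      refine ⟨q, by omega, ?_, ?_⟩
      · rw [hqedges]
        exact Finset.insert_subset huvT hsub
      · rw [hqedges, Finset.card_insert_of_notMem (by simpa using huvp), hcard]
  obtain ⟨p, hlen, hsub, hcard⟩ := hpartial T.card le_rfl
  exact ⟨p, hlen, Finset.eq_of_subset_of_card_le hsub hcard.ge⟩

/-- The edges traversed from `v` when following the successive directions in a list, where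
`next u a` is the vertex reached from `u` in direction `a`. -/
def traversedEdges {V α : Type} [DecidableEq V] (next : V → α → V) :
    V → List α → Finset (Sym2 V)
  | _, [] => ∅
  | v, a :: l => insert s(v, next v a) (traversedEdges next (next v a) l)

lemma exists_traversedEdges_eq_edges {V α : Type} [DecidableEq V] {G : SimpleGraph V}
    {next : V → α → V} (hnext : ∀ u v, G.Adj u v → ∃ a, next u a = v) {u v : V}
    (p : G.Walk u v) :
    ∃ l : List α, l.length = p.length ∧ traversedEdges next u l = p.edges.toFinset := by
  induction p with
  | nil => exact ⟨[], rfl, rfl⟩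
  | cons h p ih =>
    obtain ⟨l, hlen, hl⟩ := ih
    obtain ⟨a, rfl⟩ := hnext _ _ h
    exact ⟨a :: l, by simp [hlen], by simp [traversedEdges, hl]⟩

/-- Let `G` be a tree in which every vertex has degree exactly
`3`, with fixed root `r`.  For every `L ≥ 1`, the number of sets `T` of `L`
edges of `G` that form a connected subgraph containing `r` is finite and at
most `3^{2L} = 9^L`. -/
theorem grown_edge_sets_count {V : Type} (G : SimpleGraph V)
    (htree : G.IsTree) (hdeg : ∀ v : V, Nat.card (G.neighborSet v) = 3)
    (r : V) (L : ℕ) (hL : 1 ≤ L) :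
    {T : Finset (Sym2 V) | T.card = L ∧ (↑T : Set (Sym2 V)) ⊆ G.edgeSet ∧
        ConnFrom r (↑T : Set (Sym2 V))}.Finite ∧
    Nat.card {T : Finset (Sym2 V) | T.card = L ∧
        (↑T : Set (Sym2 V)) ⊆ G.edgeSet ∧
        ConnFrom r (↑T : Set (Sym2 V))} ≤ 9 ^ L := by
  classical
  have hfin (v : V) : Finite (G.neighborSet v) :=
    Nat.finite_of_card_ne_zero (by rw [hdeg v]; norm_num)
  let next : V → Fin 3 → V := fun v a => ((Finite.equivFinOfCardEq (hdeg v)).symm a : V)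
  have hnext : ∀ u v, G.Adj u v → ∃ a, next u a = v := fun u v h =>
    ⟨Finite.equivFinOfCardEq (hdeg u) ⟨v, h⟩, by simp [next]⟩
  let decode : List.Vector (Fin 3) (2 * L) → Finset (Sym2 V) :=
    fun l => traversedEdges next r l.toList
  have hsub : {T : Finset (Sym2 V) | T.card = L ∧ (↑T : Set (Sym2 V)) ⊆ G.edgeSet ∧
      ConnFrom r (↑T : Set (Sym2 V))} ⊆ Set.range decode := by
    rintro T ⟨hcard, hTG, hT⟩
    obtain ⟨p, hlen, hp⟩ := exists_closed_walk_of_connFrom hTG hT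
    obtain ⟨l, hl, hedges⟩ := exists_traversedEdges_eq_edges hnext p
    exact ⟨⟨l, by rw [hl, hlen, hcard]⟩, hedges.trans hp⟩
  refine ⟨(Set.finite_range decode).subset hsub, ?_⟩
  calc _ ≤ Nat.card (Set.range decode) := Nat.card_mono (Set.finite_range decode) hsub
    _ ≤ Nat.card (List.Vector (Fin 3) (2 * L)) := Finite.card_range_le decode
    _ = 9 ^ L := by rw [Nat.card_eq_fintype_card, card_vector, Fintype.card_fin, pow_mul]; norm_num
end

section
/- Let G be a simple graph that is a tree in which every vertex has degree exactly 3, with a fixed root vertex r. For every L ≥ 1 there exists a set T of L edges of G forming a connected subgraph containing r (hence a rooted tree with root r) whose number of growth sequences satisfies N(T) > L!/9^L. -/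
open SimpleGraph

/-- The combinatorial data of an infinite tree rooted at `r` in which the root has three children
and every other vertex has two. -/
structure BinaryBranching (V : Type) (r : V) where
  parent : V → V
  depth : V → ℕ
  children : V → Finset V
  mem_children : ∀ {v w : V}, w ∈ children v ↔ w ≠ r ∧ parent w = v
  depth_parent : ∀ {v : V}, v ≠ r → depth v = depth (parent v) + 1
  card_children_root : (children r).card = 3
  card_children : ∀ {v : V}, v ≠ r → (children v).card = 2

namespace BinaryBranching

open Finset
open scoped Classical

variable {V : Type} {r : V} (B : BinaryBranching V r)

/-- `A` contains the root and is closed under taking parents. -/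
def IsRooted (A : Finset V) : Prop := r ∈ A ∧ ∀ v ∈ A, v ≠ r → B.parent v ∈ A

/-- The vertices outside `A` whose parent lies in `A`. -/
noncomputable def boundary (A : Finset V) : Finset V := A.biUnion B.children \ A

variable {B}

lemma mem_boundary {A : Finset V} {w : V} :
    w ∈ B.boundary A ↔ (w ≠ r ∧ B.parent w ∈ A) ∧ w ∉ A := by
  simp only [boundary, mem_sdiff, mem_biUnion, B.mem_children]
  grind

lemma parent_ne {v : V} (hv : v ≠ r) : B.parent v ≠ v := fun h => by
  have := B.depth_parent hv
  rw [h] at this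
  omega

lemma isRooted_singleton : B.IsRooted {r} :=
  ⟨mem_singleton_self r, fun _ hv hne => (hne (mem_singleton.1 hv)).elim⟩

lemma IsRooted.insert {A : Finset V} (hA : B.IsRooted A) {v : V} (hv : v ∈ B.boundary A) :
    B.IsRooted (insert v A) := by
  refine ⟨mem_insert_of_mem hA.1, fun w hw hne => mem_insert_of_mem ?_⟩
  rcases mem_insert.1 hw with rfl | hw
  · exact (mem_boundary.1 hv).1.2
  · exact hA.2 w hw hne

lemma boundary_insert {A : Finset V} (hA : B.IsRooted A) {v : V} (hv : v ∈ B.boundary A) :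
    B.boundary (insert v A) = (B.boundary A).erase v ∪ B.children v := by
  ext w
  have h1 := mem_boundary.1 hv
  have h2 := hA.2 w
  have h3 := parent_ne (B := B) h1.1.1
  simp only [mem_boundary, mem_union, mem_erase, B.mem_children, mem_insert]
  grind

lemma card_boundary_insert {A : Finset V} (hA : B.IsRooted A) {v : V} (hv : v ∈ B.boundary A) :
    (B.boundary (insert v A)).card = (B.boundary A).card + 1 := by
  have h1 := mem_boundary.1 hv
  rw [boundary_insert hA hv, card_union_of_disjoint, card_erase_of_mem hv,
    B.card_children h1.1.1]
  · have : 0 < (B.boundary A).card := card_pos.2 ⟨v, hv⟩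
    omega
  · refine disjoint_left.2 fun w hw hw' => ?_
    have h2 := (mem_boundary.1 (mem_of_mem_erase hw)).1.2
    rw [(B.mem_children.1 hw').2] at h2
    exact h1.2 h2

lemma card_boundary_singleton : (B.boundary {r}).card = 3 := by
  have : B.boundary {r} = B.children r := by
    ext w
    simp only [mem_boundary, mem_singleton, B.mem_children]
    tauto
  rw [this, B.card_children_root]

/-- A rooted set that strictly contains `A` meets the boundary of `A`. -/
lemma IsRooted.exists_mem_boundary {A T : Finset V} (hA : B.IsRooted A) (hT : B.IsRooted T)
    (h : (T \ A).Nonempty) : ∃ v ∈ T, v ∈ B.boundary A := by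
  obtain ⟨v, hv, hmin⟩ := exists_min_image (T \ A) B.depth h
  rw [mem_sdiff] at hv
  have hne : v ≠ r := fun e => hv.2 (e ▸ hA.1)
  refine ⟨v, hv.1, mem_boundary.2 ⟨⟨hne, ?_⟩, hv.2⟩⟩
  by_contra hp
  have h1 := hmin _ (mem_sdiff.2 ⟨hT.2 v hv.1 hne, hp⟩)
  have h2 := B.depth_parent hne
  omega

/-- Counting the rooted sets that contain `A`, avoid `X` and have `m` further elements, in terms
of a bound `b` for the number of boundary vertices of `A` outside `X`. -/
lemma card_family_le (b m : ℕ) (A X : Finset V) (F : Finset (Finset V)) (hA : B.IsRooted A)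
    (hb : (B.boundary A \ X).card ≤ b)
    (hF : ∀ T ∈ F, B.IsRooted T ∧ A ⊆ T ∧ Disjoint T X ∧ T.card = A.card + m) :
    F.card * 2 ^ (b + m) ≤ 3 ^ (2 * m + b) := by
  induction hn : 2 * m + b using Nat.strong_induction_on generalizing b m A X F with
  | _ n ih =>
  subst hn
  rcases m with _ | m
  · have : F ⊆ {A} := fun T hT => by
      obtain ⟨-, h1, -, h2⟩ := hF T hT
      exact mem_singleton.2 (eq_of_subset_of_card_le h1 h2.le).symm
    calc F.card * 2 ^ (b + 0) ≤ 1 * 3 ^ b :=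
          Nat.mul_le_mul (card_le_card this) (Nat.pow_le_pow_left (by norm_num) _)
      _ = _ := by simp
  rcases (B.boundary A \ X).eq_empty_or_nonempty with he | ⟨v, hv⟩
  · have : F = ∅ := eq_empty_of_forall_notMem fun T hT => by
      obtain ⟨h1, h2, h3, h4⟩ := hF T hT
      have hne : (T \ A).Nonempty := by
        rw [← card_pos, card_sdiff_of_subset h2]
        omega
      obtain ⟨v, hvT, hv⟩ := hA.exists_mem_boundary h1 hne
      exact notMem_empty v (he ▸ mem_sdiff.2 ⟨hv, disjoint_left.1 h3 hvT⟩)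
    simp [this]
  have hv' := mem_sdiff.1 hv
  have hvA := (mem_boundary.1 hv'.1).2
  have hcard : ((B.boundary A \ X).erase v).card + 1 = (B.boundary A \ X).card :=
    card_erase_add_one hv
  obtain ⟨b, rfl⟩ : ∃ c, b = c + 1 := ⟨b - 1, by omega⟩
  have hin := ih (2 * m + (b + 2)) (by omega) (b + 2) m (insert v A) X {T ∈ F | v ∈ T}
    (hA.insert hv'.1)
    (by
      have hsub : B.boundary (insert v A) \ X ⊆ (B.boundary A \ X).erase v ∪ B.children v := by
        rw [boundary_insert hA hv'.1]
        intro w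
        simp only [mem_sdiff, mem_union, mem_erase]
        tauto
      have h1 := (card_le_card hsub).trans (card_union_le _ _)
      have h2 := B.card_children (mem_boundary.1 hv'.1).1.1
      omega)
    (fun T hT => by
      rw [mem_filter] at hT
      obtain ⟨h1, h2, h3, h4⟩ := hF T hT.1
      refine ⟨h1, insert_subset hT.2 h2, h3, ?_⟩
      rw [card_insert_of_notMem hvA, h4]
      ring) rfl
  have hout := ih (2 * (m + 1) + b) (by omega) b (m + 1) A (insert v X) {T ∈ F | v ∉ T} hA
    (by
      rw [sdiff_insert]
      omega)
    (fun T hT => by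
      rw [mem_filter] at hT
      obtain ⟨h1, h2, h3, h4⟩ := hF T hT.1
      exact ⟨h1, h2, disjoint_insert_right.2 ⟨hT.2, h3⟩, h4⟩) rfl
  rw [← card_filter_add_card_filter_not (s := F) (fun T => v ∈ T)]
  calc _ = (#{T ∈ F | v ∈ T}) * 2 ^ (b + 2 + m) + 2 * ((#{T ∈ F | v ∉ T}) * 2 ^ (b + (m + 1))) := by
        ring
    _ ≤ 3 ^ (2 * m + (b + 2)) + 2 * 3 ^ (2 * (m + 1) + b) :=
        add_le_add hin (Nat.mul_le_mul_left 2 hout)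
    _ = _ := by ring

/-- The root together with the vertices listed by `f`. -/
noncomputable def vertexSet (r : V) {n : ℕ} (f : Fin n → V) : Finset V := insert r (univ.image f)

lemma vertexSet_snoc {n : ℕ} (f : Fin n → V) (v : V) :
    vertexSet r (Fin.snoc (α := fun _ => V) f v) = insert v (vertexSet r f) := by
  ext w
  simp only [vertexSet, mem_insert, mem_image, mem_univ, true_and]
  constructor
  · rintro (h | ⟨i, rfl⟩)
    · exact .inr (.inl h)
    · induction i using Fin.lastCases with
      | last => simp
      | cast i => simp
  · rintro (rfl | h | ⟨i, rfl⟩)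
    · exact .inr ⟨Fin.last n, by simp⟩
    · exact .inl h
    · exact .inr ⟨i.castSucc, by simp⟩

variable (B) in
/-- The sequences of `n` vertices in which each vertex lies on the boundary of the set formed by
the root and the preceding vertices. -/
noncomputable def sequences : (n : ℕ) → Finset (Fin n → V)
  | 0 => {Fin.elim0}
  | n + 1 => (sequences n).biUnion fun f =>
      (B.boundary (vertexSet r f)).image fun v => Fin.snoc (α := fun _ => V) f v

lemma mem_sequences_succ {n : ℕ} {g : Fin (n + 1) → V} :
    g ∈ B.sequences (n + 1) ↔ ∃ f ∈ B.sequences n, ∃ v ∈ B.boundary (vertexSet r f),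
      Fin.snoc (α := fun _ => V) f v = g := by
  simp [sequences]

lemma vertexSet_of_mem_sequences {n : ℕ} {f : Fin n → V} (hf : f ∈ B.sequences n) :
    B.IsRooted (vertexSet r f) ∧ (vertexSet r f).card = n + 1 ∧
      (B.boundary (vertexSet r f)).card = n + 3 := by
  induction n with
  | zero =>
    have : vertexSet r f = {r} := by simp [vertexSet]
    rw [this]
    exact ⟨isRooted_singleton, card_singleton r, card_boundary_singleton⟩
  | succ n ih =>
    obtain ⟨f, hf', v, hv, rfl⟩ := mem_sequences_succ.1 hf
    obtain ⟨h1, h2, h3⟩ := ih hf'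
    rw [vertexSet_snoc]
    refine ⟨h1.insert hv, ?_, ?_⟩
    · rw [card_insert_of_notMem (mem_boundary.1 hv).2, h2]
    · rw [card_boundary_insert h1 hv, h3]

lemma card_sequences (n : ℕ) : 2 * (B.sequences n).card = (n + 2).factorial := by
  induction n with
  | zero => simp [sequences, Nat.factorial]
  | succ n ih =>
    have : (B.sequences (n + 1)).card = (B.sequences n).card * (n + 3) := by
      rw [sequences, card_biUnion]
      · refine sum_const_nat fun f hf => ?_
        rw [card_image_of_injective _ (Fin.snoc_right_injective _),
          (vertexSet_of_mem_sequences hf).2.2]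
      · refine fun f _ g _ hne => disjoint_left.2 fun h hf hg => hne ?_
        obtain ⟨v, -, rfl⟩ := mem_image.1 hf
        obtain ⟨w, -, h⟩ := mem_image.1 hg
        exact (Fin.snoc_injective2 h).1.symm
    rw [this, ← mul_assoc, ih, show n + 1 + 2 = n + 2 + 1 by ring, Nat.factorial_succ (n + 2)]
    ring

lemma properties_of_mem_sequences {n : ℕ} {f : Fin n → V} (hf : f ∈ B.sequences n) :
    Function.Injective f ∧
      ∀ k, f k ≠ r ∧ (B.parent (f k) = r ∨ ∃ j < k, f j = B.parent (f k)) := by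
  induction n with
  | zero => exact ⟨fun i => i.elim0, fun k => k.elim0⟩
  | succ n ih =>
    obtain ⟨f, hf', v, hv, rfl⟩ := mem_sequences_succ.1 hf
    obtain ⟨h1, h2⟩ := ih hf'
    rw [mem_boundary] at hv
    simp only [vertexSet, mem_insert, mem_image, mem_univ, true_and, not_or] at hv
    obtain ⟨⟨hr, hp⟩, -, hnot⟩ := hv
    refine ⟨Fin.snoc_injective_iff.2 ⟨h1, hnot⟩, fun k => ?_⟩
    induction k using Fin.lastCases with
    | last =>
      rw [Fin.snoc_last]
      refine ⟨hr, hp.imp_right ?_⟩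
      rintro ⟨j, hj⟩
      exact ⟨j.castSucc, Fin.castSucc_lt_last j, by rw [Fin.snoc_castSucc, hj]⟩
    | cast k =>
      rw [Fin.snoc_castSucc]
      refine ⟨(h2 k).1, (h2 k).2.imp_right ?_⟩
      rintro ⟨j, hj, hj'⟩
      exact ⟨j.castSucc, Fin.castSucc_lt_castSucc_iff.2 hj, by rw [Fin.snoc_castSucc, hj']⟩

/-- Some vertex set is produced by more than `n! / 9 ^ n` sequences. -/
lemma exists_vertexSet_many_sequences {n : ℕ} (hn : 1 ≤ n) :
    ∃ S : Finset V, n.factorial < #{f ∈ B.sequences n | vertexSet r f = S} * 9 ^ n := by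
  by_contra! hcon
  have hF := card_family_le (B := B) 3 n {r} ∅ ((B.sequences n).image (vertexSet r))
    isRooted_singleton (by rw [sdiff_empty, card_boundary_singleton]) (fun T hT => by
      obtain ⟨f, hf, rfl⟩ := mem_image.1 hT
      obtain ⟨h1, h2, -⟩ := vertexSet_of_mem_sequences hf
      exact ⟨h1, singleton_subset_iff.2 h1.1, disjoint_empty_right _, by
        rw [h2, card_singleton, add_comm]⟩)
  set F := (B.sequences n).image (vertexSet r)
  have hsum : (B.sequences n).card * 9 ^ n ≤ F.card * n.factorial := by
    rw [card_eq_sum_card_image (vertexSet r) (B.sequences n), sum_mul, ← smul_eq_mul]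
    exact sum_le_card_nsmul _ _ _ fun S _ => hcon S
  have hfac : (n + 2).factorial = (n + 2) * ((n + 1) * n.factorial) := by
    rw [Nat.factorial_succ, Nat.factorial_succ]
  have hcard := card_sequences (B := B) n
  have hpos := n.factorial_pos
  have hpow : 3 ^ (2 * n + 3) = 27 * 9 ^ n := by
    rw [pow_add, pow_mul]
    ring
  have hle : (n + 2) * (n + 1) * 9 ^ n ≤ 2 * F.card := by
    refine Nat.le_of_mul_le_mul_right ?_ hpos
    calc (n + 2) * (n + 1) * 9 ^ n * n.factorial = 2 * (B.sequences n).card * 9 ^ n := by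
          rw [hcard, hfac]
          ring
      _ ≤ 2 * F.card * n.factorial := by
          rw [mul_assoc, mul_assoc]
          exact Nat.mul_le_mul_left 2 hsum
  have h6 : 3 * 2 ≤ (n + 2) * (n + 1) := Nat.mul_le_mul (by omega) (by omega)
  have h16 : 2 ^ 4 ≤ 2 ^ (3 + n) := Nat.pow_le_pow_right (by norm_num) (by omega)
  have h9 : 0 < 9 ^ n := by positivity
  have hlow : 6 * 9 ^ n ≤ 2 * F.card := (Nat.mul_le_mul_right _ h6).trans hle
  have hup : F.card * 2 ^ 4 ≤ 27 * 9 ^ n := by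
    rw [← hpow]
    exact (Nat.mul_le_mul_left _ h16).trans hF
  omega

variable (B) in
/-- The edge joining a vertex to its parent. -/
def parentEdge (v : V) : Sym2 V := s(v, B.parent v)

lemma parentEdge_injOn : Set.InjOn B.parentEdge {v | v ≠ r} := fun v hv w hw h => by
  rcases Sym2.eq_iff.1 h with ⟨h, -⟩ | ⟨h1, h2⟩
  · exact h
  · have h3 := B.depth_parent hv
    have h4 := B.depth_parent hw
    rw [h2] at h3
    rw [← h1] at h4
    omega

lemma connFrom_image_of_mem_sequences {n : ℕ} {f : Fin n → V} (hf : f ∈ B.sequences n)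
    (k : Fin n) : ConnFrom r ((B.parentEdge ∘ f) '' {i | i ≤ k}) := by
  have hprop := (properties_of_mem_sequences hf).2
  set S := (B.parentEdge ∘ f) '' {i | i ≤ k}
  have hadj : ∀ i ≤ k, (SimpleGraph.fromEdgeSet S).Adj (B.parent (f i)) (f i) := fun i hi =>
    ((SimpleGraph.fromEdgeSet_adj S).2 ⟨⟨i, hi, rfl⟩, (parent_ne (hprop i).1).symm⟩).symm
  have hreach : ∀ i ≤ k, (SimpleGraph.fromEdgeSet S).Reachable r (B.parent (f i)) := by
    intro i
    induction i using WellFoundedLT.induction with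
    | _ i ih =>
    intro hi
    rcases (hprop i).2 with h | ⟨j, hj, h⟩
    · rw [h]
    · rw [← h]
      exact (ih j hj (hj.le.trans hi)).trans (hadj j (hj.le.trans hi)).reachable
  rintro _ ⟨i, hi, rfl⟩ v hv
  rcases Sym2.mem_iff.1 hv with rfl | rfl
  · exact (hreach i hi).trans (hadj i hi).reachable
  · exact hreach i hi

lemma image_parentEdge_vertexSet {n : ℕ} {f : Fin n → V} (hf : f ∈ B.sequences n) :
    ((((vertexSet r f).erase r).image B.parentEdge : Finset (Sym2 V)) : Set (Sym2 V)) =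
      Set.range (B.parentEdge ∘ f) := by
  have hr : ∀ k, f k ≠ r := fun k => ((properties_of_mem_sequences hf).2 k).1
  ext e
  simp only [vertexSet, coe_image, Set.mem_image, mem_coe, mem_erase, mem_insert, mem_image,
    mem_univ, true_and, Set.mem_range, Function.comp_apply]
  grind

lemma parentEdge_comp_mem_growthSeqs {n : ℕ} {f : Fin n → V} (hf : f ∈ B.sequences n) :
    B.parentEdge ∘ f ∈
      growthSeqs r (((vertexSet r f).erase r).image B.parentEdge : Finset (Sym2 V)) n := by
  obtain ⟨hinj, hprop⟩ := properties_of_mem_sequences hf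
  exact ⟨fun i j h => hinj (parentEdge_injOn (hprop i).1 (hprop j).1 h),
    (image_parentEdge_vertexSet hf).symm, connFrom_image_of_mem_sequences hf⟩

end BinaryBranching

lemma finite_growthSeqs {V : Type} (r : V) (T : Finset (Sym2 V)) (L : ℕ) :
    (growthSeqs r (T : Set (Sym2 V)) L).Finite := by
  refine (Set.Finite.pi' (t := fun _ : Fin L => (T : Set (Sym2 V)))
    fun _ => T.finite_toSet).subset fun f hf i => ?_
  rw [← hf.2.1]
  exact Set.mem_range_self i

open scoped Classical in
/-- The parent edges of a vertex set `S` have at least as many growth sequences as there are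
vertex sequences producing `S`. -/
lemma BinaryBranching.card_fiber_le_Ngrowth {V : Type} {r : V} (B : BinaryBranching V r) (n : ℕ)
    (S : Finset V) :
    ({f ∈ B.sequences n | vertexSet r f = S} : Finset _).card ≤
      Ngrowth r ((S.erase r).image B.parentEdge : Finset (Sym2 V)) n := by
  rw [Ngrowth, Nat.card_coe_set_eq, ← Set.ncard_coe_finset]
  refine Set.ncard_le_ncard_of_injOn (B.parentEdge ∘ ·) ?_ ?_ (finite_growthSeqs r _ n)
  · intro f hf
    obtain ⟨hmem, rfl⟩ := Finset.mem_filter.1 (Finset.mem_coe.1 hf)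
    exact parentEdge_comp_mem_growthSeqs hmem
  · intro f hf g hg h
    have hf' := (properties_of_mem_sequences (Finset.mem_filter.1 (Finset.mem_coe.1 hf)).1).2
    have hg' := (properties_of_mem_sequences (Finset.mem_filter.1 (Finset.mem_coe.1 hg)).1).2
    exact funext fun i => parentEdge_injOn (hf' i).1 (hg' i).1 (congrFun h i)

namespace SimpleGraph

variable {V : Type} {G : SimpleGraph V}

lemma Connected.exists_adj_dist_eq_add_one (hG : G.Connected) {r v : V} (hv : v ≠ r) :
    ∃ w, G.Adj v w ∧ G.dist r v = G.dist r w + 1 := by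
  obtain ⟨p, hp⟩ := hG.exists_walk_length_eq_dist v r
  cases p with
  | nil => exact (hv rfl).elim
  | @cons _ w _ h p =>
    refine ⟨w, h, ?_⟩
    have h1 := dist_le p
    have h2 := h.diff_dist_adj (u := r)
    rw [Walk.length_cons, dist_comm] at hp
    rw [dist_comm] at h1
    omega

lemma IsTree.eq_of_adj_of_dist_eq_add_one (hG : G.IsTree) {r v w w' : V}
    (hw : G.Adj v w) (hdw : G.dist r v = G.dist r w + 1)
    (hw' : G.Adj v w') (hdw' : G.dist r v = G.dist r w' + 1) : w = w' := by
  obtain ⟨p, hp⟩ := hG.connected.exists_walk_length_eq_dist r w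
  obtain ⟨q, hq⟩ := hG.connected.exists_walk_length_eq_dist r w'
  have h := (hG.existsUnique_path r v).unique
    ((p.concat hw.symm).isPath_of_length_eq_dist (by rw [Walk.length_concat, hp, hdw]))
    ((q.concat hw'.symm).isPath_of_length_eq_dist (by rw [Walk.length_concat, hq, hdw']))
  simpa using congrArg Walk.penultimate h

/-- In a tree all of whose vertices have degree three, every root induces a `BinaryBranching`
along the edges of the tree. -/
lemma IsTree.exists_binaryBranching (hG : G.IsTree)
    (hdeg : ∀ v : V, Nat.card (G.neighborSet v) = 3) (r : V) :
    ∃ B : BinaryBranching V r, ∀ v ≠ r, G.Adj v (B.parent v) := by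
  classical
  have hex : ∀ v, ∃ w, v ≠ r → G.Adj v w ∧ G.dist r v = G.dist r w + 1 := fun v => by
    by_cases hv : v = r
    · exact ⟨r, fun h => (h hv).elim⟩
    · exact (hG.connected.exists_adj_dist_eq_add_one hv).imp fun _ h _ => h
  choose par hpar using hex
  have hfin : ∀ v, (G.neighborSet v).Finite := fun v =>
    Set.finite_of_ncard_pos (by rw [← Nat.card_coe_set_eq, hdeg]; norm_num)
  have hncard : ∀ v, (hfin v).toFinset.card = 3 := fun v => by
    rw [← Set.ncard_eq_toFinset_card _ (hfin v), ← Nat.card_coe_set_eq, hdeg]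
  have hmem : ∀ {v w : V},
      w ∈ (hfin v).toFinset.filter (fun w => G.dist r w = G.dist r v + 1) ↔
        w ≠ r ∧ par w = v := by
    intro v w
    rw [Finset.mem_filter, Set.Finite.mem_toFinset, mem_neighborSet]
    constructor
    · rintro ⟨h1, h2⟩
      have hw : w ≠ r := by
        rintro rfl
        rw [dist_self] at h2
        omega
      exact ⟨hw, hG.eq_of_adj_of_dist_eq_add_one (hpar w hw).1 (hpar w hw).2 h1.symm h2⟩
    · rintro ⟨hw, rfl⟩
      exact ⟨(hpar w hw).1.symm, (hpar w hw).2⟩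
  refine ⟨⟨par, G.dist r, fun v => (hfin v).toFinset.filter
    (fun w => G.dist r w = G.dist r v + 1), hmem, fun hv => (hpar _ hv).2, ?_, ?_⟩,
    fun v hv => (hpar v hv).1⟩
  · rw [Finset.filter_true_of_mem, hncard]
    intro w hw
    rw [Set.Finite.mem_toFinset, mem_neighborSet] at hw
    rw [dist_self, dist_eq_one_iff_adj.2 hw]
  · intro v hv
    have : (hfin v).toFinset.filter (fun w => G.dist r w = G.dist r v + 1) =
        (hfin v).toFinset.erase (par v) := by
      ext w
      rw [Finset.mem_filter, Finset.mem_erase, Set.Finite.mem_toFinset, mem_neighborSet]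
      have hp := hpar v hv
      constructor
      · rintro ⟨h1, h2⟩
        refine ⟨?_, h1⟩
        rintro rfl
        omega
      · rintro ⟨h1, h2⟩
        refine ⟨h2, (hG.dist_eq_dist_add_one_of_adj r h2).resolve_left fun h => h1 ?_⟩
        exact hG.eq_of_adj_of_dist_eq_add_one h2 h hp.1 hp.2
    rw [this, Finset.card_erase_of_mem, hncard]
    rw [Set.Finite.mem_toFinset, mem_neighborSet]
    exact (hpar v hv).1

end SimpleGraph

/-- Let `G` be a tree in which every vertex has degree exactly
`3`, with fixed root `r`.  For every `L ≥ 1` there exists a set `T` of `L`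
edges of `G` forming a connected subgraph containing `r` whose number of growth
sequences satisfies `N(T) > L!/9^L`. -/
theorem exists_tree_many_growth_seqs {V : Type} (G : SimpleGraph V)
    (htree : G.IsTree) (hdeg : ∀ v : V, Nat.card (G.neighborSet v) = 3)
    (r : V) (L : ℕ) (hL : 1 ≤ L) :
    ∃ T : Finset (Sym2 V), T.card = L ∧
      (↑T : Set (Sym2 V)) ⊆ G.edgeSet ∧
      ConnFrom r (↑T : Set (Sym2 V)) ∧
      (L.factorial : ℝ) / 9 ^ L < Ngrowth r (↑T) L := by
  classical
  obtain ⟨B, hB⟩ := htree.exists_binaryBranching hdeg r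
  obtain ⟨S, hS⟩ := B.exists_vertexSet_many_sequences hL
  have hle := B.card_fiber_le_Ngrowth L S
  obtain ⟨f, hfS⟩ := Finset.card_pos.1 (Nat.pos_of_mul_pos_right (Nat.zero_lt_of_lt hS))
  obtain ⟨hf, rfl⟩ := Finset.mem_filter.1 hfS
  have hmem := BinaryBranching.parentEdge_comp_mem_growthSeqs hf
  refine ⟨((BinaryBranching.vertexSet r f).erase r).image B.parentEdge, ?_, ?_, ?_, ?_⟩
  · rw [← Set.ncard_coe_finset, ← hmem.2.1, ← Set.image_univ,
      Set.ncard_image_of_injective _ hmem.1, Set.ncard_univ, Nat.card_fin]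
  · rw [← hmem.2.1]
    rintro _ ⟨k, rfl⟩
    exact hB _ ((BinaryBranching.properties_of_mem_sequences hf).2 k).1
  · have h := hmem.2.2 ⟨L - 1, by omega⟩
    rwa [show {i : Fin L | i ≤ ⟨L - 1, by omega⟩} = Set.univ from
      Set.eq_univ_of_forall fun i => Fin.le_def.2 (by simp; omega), Set.image_univ,
      hmem.2.1] at h
  · rw [div_lt_iff₀ (by positivity)]
    exact_mod_cast hS.trans_le (Nat.mul_le_mul_right _ (by convert hle))
end

section
/- Let T be a finite rooted tree with L edges and root r, let S ⊆ T be a set of edges forming a connected subgraph containing r, and let T_1, …, T_m be the edge sets of the connected components of T with the edges of S removed, each T_i regarded as a rooted tree with root at its unique vertex lying on S. Then W(T) = (∏_{e ∈ S} w_T(e)) · ∏_{i=1}^m W(T_i), and consequently W(T) ≤ L^{|S|} · ∏_{i=1}^m W(T_i). -/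
open SimpleGraph

/-- The vertices covered by an edge set `T` together with the root `r`. -/
def covered {V : Type} (r : V) (T : Set (Sym2 V)) : Set V :=
  insert r {v | ∃ e ∈ T, v ∈ e}

theorem mem_of_mem_edges_fromEdgeSet {V : Type} {A : Set (Sym2 V)} {u v : V}
    (p : (SimpleGraph.fromEdgeSet A).Walk u v) {e : Sym2 V} (he : e ∈ p.edges) : e ∈ A := by
  have h := p.edges_subset_edgeSet he
  rw [SimpleGraph.edgeSet_fromEdgeSet] at h
  exact h.1

theorem reachable_of_mem_covered {V : Type} {r v : V} {A : Set (Sym2 V)} (hA : ConnFrom r A)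
    (hv : v ∈ covered r A) : (SimpleGraph.fromEdgeSet A).Reachable v r := by
  rcases hv with rfl | ⟨e, he, hve⟩
  · exact SimpleGraph.Reachable.refl _
  · exact (hA e he v hve).symm

/-- If `P ⊆ T` can only be left through the vertex `x`, then every walk in `T` from a vertex of
`P` to a vertex `r` outside `P` (or to `x`) contains the edges of a walk in `P` to `x`. -/
theorem exists_walk_to_attachment {V : Type} {x r : V} {T P : Set (Sym2 V)}
    (hr : r ∈ covered x P → r = x)
    (hleave : ∀ e ∈ T, e ∉ P → ∀ v ∈ e, v ∈ covered x P → v = x)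
    {v : V} (p : (SimpleGraph.fromEdgeSet T).Walk v r) (hv : v ∈ covered x P) :
    ∃ q : (SimpleGraph.fromEdgeSet P).Walk v x, q.edges ⊆ p.edges := by
  induction p with
  | nil =>
    obtain rfl := hr hv
    exact ⟨SimpleGraph.Walk.nil, by simp⟩
  | @cons v u w h p ih =>
    by_cases hvx : v = x
    · subst hvx
      exact ⟨SimpleGraph.Walk.nil, by simp⟩
    · rw [SimpleGraph.fromEdgeSet_adj] at h
      have hP : s(v, u) ∈ P := by
        by_contra hP
        exact hvx (hleave _ h.1 hP v (Sym2.mem_mk_left v u) hv)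
      obtain ⟨q, hq⟩ := ih hr (Or.inr ⟨_, hP, Sym2.mem_mk_right v u⟩)
      refine ⟨SimpleGraph.Walk.cons ((SimpleGraph.fromEdgeSet_adj _).2 ⟨hP, h.2⟩) q, ?_⟩
      simp only [SimpleGraph.Walk.edges_cons]
      exact List.cons_subset_cons _ hq

/-- An edge has weight at most the number of edges of the tree. -/
theorem wEdge_le_card {V : Type} (r : V) {T : Finset (Sym2 V)} {e : Sym2 V} (he : e ∈ T) :
    wEdge r (↑T) e ≤ T.card := by
  classical
  have hsub : {e' : Sym2 V | Downstream r (↑T) e e'} ⊆ ↑(T.erase e) := by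
    intro e' h
    exact Finset.mem_coe.2 (Finset.mem_erase.2 ⟨h.2.1, h.1⟩)
  have hcard := Set.ncard_le_ncard hsub (Finset.finite_toSet _)
  rw [Set.ncard_coe_finset] at hcard
  have := Finset.card_erase_add_one he
  change 1 + Set.ncard _ ≤ _
  omega

/-- Let `T` be a finite rooted tree with `L` edges and root
`r`, let `S ⊆ T` form a connected subgraph containing `r`, and let
`T_1, …, T_m` be the edge sets of the connected components of `T` with the
edges of `S` removed, each `T_i` rooted at its unique vertex lying on `S`.
Then `W(T) = (∏_{e ∈ S} w_T(e)) · ∏ᵢ W(T_i)`, and consequently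
`W(T) ≤ L^{|S|} · ∏ᵢ W(T_i)`. -/
theorem weight_decomposition {V : Type} (r : V)
    (T : Finset (Sym2 V)) (L : ℕ) (hL : T.card = L)
    (hdiag : ∀ e ∈ T, ¬ e.IsDiag)
    (hconn : ConnFrom r (↑T : Set (Sym2 V)))
    (hacyclic : (SimpleGraph.fromEdgeSet (↑T : Set (Sym2 V))).IsAcyclic)
    (hroot : T.Nonempty → ∃ e ∈ T, r ∈ e)
    (S : Finset (Sym2 V)) (hS : S ⊆ T)
    (hSconn : ConnFrom r (↑S : Set (Sym2 V)))
    (m : ℕ) (parts : Fin m → Finset (Sym2 V)) (roots : Fin m → V)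
    -- the `parts` are exactly the edge sets of the connected components of
    -- `T` with the edges of `S` removed:
    (hcover : ∀ e : Sym2 V, (e ∈ T ∧ e ∉ S) ↔ ∃ i : Fin m, e ∈ parts i)
    (hne : ∀ i : Fin m, (parts i).Nonempty)
    (hdisj : ∀ i j : Fin m, i ≠ j → Disjoint (parts i) (parts j))
    (hpartconn : ∀ i : Fin m, ConnFrom (roots i) (↑(parts i) : Set (Sym2 V)))
    -- the root of each component is its unique vertex lying on `S`:
    (hpartroot : ∀ i : Fin m, roots i ∈ covered r (↑S : Set (Sym2 V)))
    (hattach : ∀ i : Fin m, ∀ v : V,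
      v ∈ covered (roots i) (↑(parts i) : Set (Sym2 V)) →
      v ∈ covered r (↑S : Set (Sym2 V)) → v = roots i)
    -- distinct components share no vertices:
    (hvdisj : ∀ i j : Fin m, i ≠ j → ∀ v : V,
      v ∈ covered (roots i) (↑(parts i) : Set (Sym2 V)) →
      v ∈ covered (roots j) (↑(parts j) : Set (Sym2 V)) → False) :
    Wtree r T = (∏ e ∈ S, wEdge r (↑T) e) * ∏ i : Fin m, Wtree (roots i) (parts i) ∧
    Wtree r T ≤ L ^ S.card * ∏ i : Fin m, Wtree (roots i) (parts i) := by
  classical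
  have hST : SimpleGraph.fromEdgeSet (↑S : Set (Sym2 V)) ≤ SimpleGraph.fromEdgeSet ↑T :=
    SimpleGraph.fromEdgeSet_mono (Finset.coe_subset.2 hS)
  have hpT : ∀ i, parts i ⊆ T := fun i e he => ((hcover e).2 ⟨i, he⟩).1
  have hpS : ∀ i, ∀ e ∈ parts i, e ∉ S := fun i e he => ((hcover e).2 ⟨i, he⟩).2
  have hPT : ∀ i, SimpleGraph.fromEdgeSet (↑(parts i) : Set (Sym2 V)) ≤
      SimpleGraph.fromEdgeSet ↑T :=
    fun i => SimpleGraph.fromEdgeSet_mono (Finset.coe_subset.2 (hpT i))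
  have hweight : ∀ i, ∀ e ∈ parts i, wEdge r (↑T) e = wEdge (roots i) (↑(parts i)) e := by
    intro i e he
    suffices h : ∀ e', Downstream r (↑T) e e' ↔ Downstream (roots i) (↑(parts i)) e e' by
      simp only [wEdge, h]
    -- a walk inside a part to its root extends to `r` along `S`
    have hext : ∀ j v (q : (SimpleGraph.fromEdgeSet (↑(parts j) : Set (Sym2 V))).Walk v (roots j)),
        (∀ p : (SimpleGraph.fromEdgeSet (↑T : Set (Sym2 V))).Walk v r, e ∈ p.edges) →
        e ∈ q.edges := by
      intro j v q h
      obtain ⟨s⟩ := reachable_of_mem_covered hSconn (hpartroot j)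
      have hmem := h ((q.mapLe (hPT j)).append (s.mapLe hST))
      rw [SimpleGraph.Walk.edges_append, SimpleGraph.Walk.edges_mapLe_eq_edges,
        SimpleGraph.Walk.edges_mapLe_eq_edges, List.mem_append] at hmem
      exact hmem.resolve_right fun hs => hpS i e he (mem_of_mem_edges_fromEdgeSet s hs)
    intro e'
    constructor
    · rintro ⟨heT, hee, hwalk⟩
      have hv := e'.out_fst_mem
      have hpart : e' ∈ parts i := by
        by_cases heS : e' ∈ S
        · obtain ⟨s⟩ := (hSconn e' heS _ hv).symm
          have hmem := hwalk _ hv (s.mapLe hST)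
          rw [SimpleGraph.Walk.edges_mapLe_eq_edges] at hmem
          exact absurd (mem_of_mem_edges_fromEdgeSet s hmem) (hpS i e he)
        · obtain ⟨j, hj⟩ := (hcover e').1 ⟨heT, heS⟩
          obtain ⟨q⟩ := (hpartconn j e' hj _ hv).symm
          have hej := mem_of_mem_edges_fromEdgeSet q (hext j _ q (hwalk _ hv))
          by_cases hij : i = j
          · exact hij ▸ hj
          · exact absurd hej (Finset.disjoint_left.1 (hdisj i j hij) he)
      exact ⟨hpart, hee, fun v hv q => hext i v q (hwalk v hv)⟩
    · rintro ⟨hpart, hee, hwalk⟩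
      refine ⟨hpT i hpart, hee, fun v hv p => ?_⟩
      obtain ⟨q, hq⟩ := exists_walk_to_attachment (P := ↑(parts i)) (x := roots i)
        (fun h => hattach i r h (Or.inl rfl))
        (fun f hfT hfP u hu huP => by
          by_cases hfS : f ∈ S
          · exact hattach i u huP (Or.inr ⟨f, hfS, hu⟩)
          · obtain ⟨j, hj⟩ := (hcover f).1 ⟨hfT, hfS⟩
            by_cases hij : i = j
            · exact absurd (Finset.mem_coe.2 (hij ▸ hj)) hfP
            · exact (hvdisj i j hij u huP (Or.inr ⟨f, hj, hu⟩)).elim)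
        p (Or.inr ⟨e', hpart, hv⟩)
      exact hq (hwalk v hv q)
  have hsdiff : T \ S = Finset.univ.biUnion parts := by
    ext e
    simp [hcover e]
  have hprod : Wtree r T =
      (∏ e ∈ S, wEdge r (↑T) e) * ∏ i : Fin m, Wtree (roots i) (parts i) := by
    unfold Wtree
    rw [← Finset.prod_sdiff hS, mul_comm, hsdiff,
      Finset.prod_biUnion fun i _ j _ hij => hdisj i j hij]
    congr 1
    exact Finset.prod_congr rfl fun i _ => Finset.prod_congr rfl (hweight i)
  refine ⟨hprod, hprod.trans_le (Nat.mul_le_mul_right _ ?_)⟩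
  exact Finset.prod_le_pow_card _ _ _ fun e he => hL ▸ wEdge_le_card r (hS he)
end
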